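/- Let S be a finite alphabet with a complementation, let d ≥ 4, and let V, W ⊆ S^d be nonempty, disjoint and equivalent polybox codes such that neither V nor W contains a twin pair. Then |V| ≥ 12. -/

import Mathlib

variable {S : Type}

/-- Two words are dichotomous: at some position they carry complementary letters. -/
def Dicho {d : ℕ} (c : S → S) (u v : Fin d → S) : Prop := ∃ j, v j = c (u j)

/-- Two words form a twin pair. -/
def TwinPair {d : ℕ} (c : S → S) (u v : Fin d → S) : Prop :=
  ∃ j, v j = c (u j) ∧ ∀ i, i ≠ j → v i = u i

/-- A polybox code: a set of pairwise dichotomous words. -/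
def PolyboxCode {d : ℕ} (c : S → S) (V : Set (Fin d → S)) : Prop :=
  ∀ u ∈ V, ∀ v ∈ V, u ≠ v → Dicho c u v

/-- The code contains no twin pair. -/
def NoTwinPair {d : ℕ} (c : S → S) (V : Set (Fin d → S)) : Prop :=
  ∀ u ∈ V, ∀ v ∈ V, ¬ TwinPair c u v

/-- `ES`: sets containing exactly one of `s`, `s'` for every letter `s`. -/
def ESet (c : S → S) : Set (Set S) := {B | ∀ s, Xor' (s ∈ B) (c s ∈ B)}

/-- `Es`: members of `ES` containing the letter `s`. -/
def ELetter (c : S → S) (s : S) : Set (Set S) := {B | B ∈ ESet c ∧ s ∈ B}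

/-- The equicomplementary realization `v̌ ⊆ (ES)^d` of a word `v`. -/
def Realize {d : ℕ} (c : S → S) (v : Fin d → S) : Set (Fin d → Set S) :=
  {x | ∀ i, x i ∈ ELetter c (v i)}

/-- The union `⋃_{v ∈ V} v̌`. -/
def RealizeSet {d : ℕ} (c : S → S) (V : Set (Fin d → S)) : Set (Fin d → Set S) :=
  ⋃ v ∈ V, Realize c v

/-- Two codes are equivalent if their realizations coincide. -/
def EquivCodes {d : ℕ} (c : S → S) (V W : Set (Fin d → S)) : Prop :=
  RealizeSet c V = RealizeSet c W

/-- A partition code: a polybox code whose realization is the whole box `(ES)^d`. -/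
def PartitionCode {d : ℕ} (c : S → S) (U : Set (Fin d → S)) : Prop :=
  PolyboxCode c U ∧ RealizeSet c U = {x | ∀ i, x i ∈ ESet c}

/-- `V^{i,l}`: the words of `V` with letter `l` at position `i`. -/
def Subcode {d : ℕ} (V : Set (Fin d → S)) (i : Fin d) (l : S) : Set (Fin d → S) :=
  {v | v ∈ V ∧ v i = l}

namespace Polybox

open scoped Classical

/-- A complementation: a fixed-point-free involution of the alphabet. -/
class Complementation (c : S → S) : Prop where
  invol : ∀ s, c (c s) = s
  ne : ∀ s, c s ≠ s

/-- Two letters are equal or complementary. -/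
def SamePair (c : S → S) (a s : S) : Prop := a = s ∨ a = c s

section Basic

variable {ι : Type} {c : S → S}

/-- A point of the box `(ES)^ι`. -/
def Transversal (c : S → S) (x : ι → Set S) : Prop := ∀ i, x i ∈ ESet c

/-- The point `x` lies in the realization of `v`, as far as the positions in `J` are concerned. -/
def MemOn (J : Finset ι) (x : ι → Set S) (v : ι → S) : Prop := ∀ j ∈ J, v j ∈ x j

/-- The words are dichotomous at a position in `J`. -/
def DichoOn (c : S → S) (J : Finset ι) (u v : ι → S) : Prop := ∃ j ∈ J, v j = c (u j)

/-- The restrictions of the words to `J` form a twin pair. -/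
def TwinOn (c : S → S) (J : Finset ι) (u v : ι → S) : Prop :=
  ∃ j ∈ J, v j = c (u j) ∧ ∀ i ∈ J, i ≠ j → v i = u i

/-- The restrictions of the words to `J` coincide. -/
def AgreeOn (J : Finset ι) (u v : ι → S) : Prop := ∀ j ∈ J, u j = v j

/-- The restrictions to `J` of the words of `V` form a polybox code without twin pairs. -/
structure TwinFree (c : S → S) (J : Finset ι) (V : Finset (ι → S)) : Prop where
  dich : ∀ u ∈ V, ∀ v ∈ V, u ≠ v → DichoOn c J u v
  twin : ∀ u ∈ V, ∀ v ∈ V, ¬ TwinOn c J u v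

/-- Disjoint equivalent polybox codes without twin pairs, with words restricted to `J`. -/
structure Sys (c : S → S) (J : Finset ι) (V W : Finset (ι → S)) : Prop where
  left : TwinFree c J V
  right : TwinFree c J W
  disj : ∀ v ∈ V, ∀ w ∈ W, ¬ AgreeOn J v w
  eqv : ∀ x, Transversal c x → ((∃ v ∈ V, MemOn J x v) ↔ ∃ w ∈ W, MemOn J x w)

/-- The words of `V` with letter `l` at position `i`. -/
noncomputable def sl (V : Finset (ι → S)) (i : ι) (l : S) : Finset (ι → S) := V.filter (fun v => v i = l)

theorem mem_sl {V : Finset (ι → S)} {i : ι} {l : S} {v : ι → S} :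
    v ∈ sl V i l ↔ v ∈ V ∧ v i = l := by
  simp [sl]

theorem sl_subset (V : Finset (ι → S)) (i : ι) (l : S) : sl V i l ⊆ V :=
  Finset.filter_subset _ _

theorem AgreeOn.symm {J : Finset ι} {u v : ι → S} (h : AgreeOn J u v) : AgreeOn J v u :=
  fun j hj => (h j hj).symm

theorem AgreeOn.mem {J : Finset ι} {u v : ι → S} (h : AgreeOn J u v) {x : ι → Set S}
    (hx : MemOn J x u) : MemOn J x v := fun j hj => h j hj ▸ hx j hj

theorem MemOn.mono {J K : Finset ι} (hK : K ⊆ J) {x : ι → Set S} {v : ι → S}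
    (h : MemOn J x v) : MemOn K x v := fun j hj => h j (hK hj)

theorem DichoOn.mono {J K : Finset ι} (hK : K ⊆ J) {u v : ι → S}
    (h : DichoOn c K u v) : DichoOn c J u v := by
  obtain ⟨j, hj, h⟩ := h
  exact ⟨j, hK hj, h⟩

theorem TwinFree.mono {J : Finset ι} {V W : Finset (ι → S)} (hW : W ⊆ V) (h : TwinFree c J V) :
    TwinFree c J W :=
  ⟨fun u hu v hv => h.dich u (hW hu) v (hW hv), fun u hu v hv => h.twin u (hW hu) v (hW hv)⟩

theorem Sys.symm {J : Finset ι} {V W : Finset (ι → S)} (h : Sys c J V W) : Sys c J W V :=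
  ⟨h.right, h.left, fun w hw v hv hvw => h.disj v hv w hw hvw.symm, fun x hx => (h.eqv x hx).symm⟩

theorem memOn_update_iff {J : Finset ι} {i : ι} (hi : i ∈ J) {x : ι → Set S} {B : Set S}
    {v : ι → S} : MemOn J (Function.update x i B) v ↔ v i ∈ B ∧ MemOn (J.erase i) x v := by
  constructor
  · intro h
    refine ⟨by simpa using h i hi, fun j hj => ?_⟩
    have := h j (Finset.mem_of_mem_erase hj)
    rwa [Function.update_of_ne (Finset.ne_of_mem_erase hj)] at this
  · rintro ⟨h1, h2⟩ j hj
    by_cases hji : j = i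
    · subst hji; simpa using h1
    · rw [Function.update_of_ne hji]
      exact h2 j (Finset.mem_erase.2 ⟨hji, hj⟩)

theorem memOn_iff {J : Finset ι} {i : ι} (hi : i ∈ J) {x : ι → Set S} {v : ι → S} :
    MemOn J x v ↔ v i ∈ x i ∧ MemOn (J.erase i) x v := by
  simpa using memOn_update_iff hi (x := x) (B := x i) (v := v)

variable [Complementation c]

omit [Complementation c] in
theorem transversal_update {x : ι → Set S} (hx : Transversal c x) (i : ι) {B : Set S}
    (hB : B ∈ ESet c) : Transversal c (Function.update x i B) := by
  intro j
  by_cases hji : j = i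
  · subst hji; simpa using hB
  · simpa [Function.update_of_ne hji] using hx j

omit [Complementation c] in
theorem compl_mem_iff {B : Set S} (hB : B ∈ ESet c) (s : S) : c s ∈ B ↔ s ∉ B := by
  have := xor_def.1 (hB s)
  tauto

theorem samePair_symm {a s : S} (h : SamePair c a s) : SamePair c s a := by
  rcases h with h | h
  · exact Or.inl h.symm
  · exact Or.inr (by rw [h, Complementation.invol (c := c)])

theorem samePair_compl {a s : S} : SamePair c a (c s) ↔ SamePair c a s := by
  simp only [SamePair, Complementation.invol]
  tauto

theorem samePair_trans {a b s : S} (h : SamePair c a b) (h' : SamePair c b s) :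
    SamePair c a s := by
  rcases h with rfl | rfl <;> rcases h' with rfl | rfl <;>
    simp [SamePair, Complementation.invol]

theorem DichoOn.symm {J : Finset ι} {u v : ι → S} (h : DichoOn c J u v) : DichoOn c J v u := by
  obtain ⟨j, hj, h⟩ := h
  exact ⟨j, hj, by rw [h, Complementation.invol (c := c)]⟩

theorem exists_eSet : ∃ B : Set S, B ∈ ESet c := by
  let _ : LinearOrder S := linearOrderOfSTO WellOrderingRel
  refine ⟨{s | s < c s}, fun s => ?_⟩
  have h1 := Complementation.ne (c := c) s
  simp only [Set.mem_ofPred_eq, Complementation.invol (c := c) s]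
  rcases lt_trichotomy s (c s) with h | h | h
  · exact Or.inl ⟨h, h.not_gt⟩
  · exact absurd h.symm h1
  · exact Or.inr ⟨h, h.not_gt⟩

theorem exists_eSet_superset (A : Set S) (hA : ∀ s ∈ A, c s ∉ A) :
    ∃ B ∈ ESet c, A ⊆ B := by
  obtain ⟨B, hB⟩ := exists_eSet (c := c)
  refine ⟨{s | s ∈ A ∨ (c s ∉ A ∧ s ∈ B)}, fun s => ?_, fun s hs => Or.inl hs⟩
  have h1 := compl_mem_iff hB s
  have h2 := hA s
  have h3 := hA (c s)
  simp only [Set.mem_ofPred_eq, Complementation.invol] at *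
  tauto

theorem exists_transversal (A : ι → Set S) (hA : ∀ i, ∀ s ∈ A i, c s ∉ A i) :
    ∃ x, Transversal c x ∧ ∀ i, A i ⊆ x i := by
  choose B hB hAB using fun i => exists_eSet_superset (c := c) (A i) (hA i)
  exact ⟨B, hB, hAB⟩

theorem exists_eSet_pair {s t : S} (h : t ≠ c s) : ∃ B ∈ ESet c, s ∈ B ∧ t ∈ B := by
  obtain ⟨B, hB, hAB⟩ := exists_eSet_superset (c := c) {s, t} (by
    have h1 := Complementation.ne (c := c) s
    have h2 := Complementation.ne (c := c) t
    have h3 : s ≠ c t := fun h' => h (by rw [h', Complementation.invol (c := c)])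
    rintro a (rfl | rfl) <;> simp <;> tauto)
  exact ⟨B, hB, hAB (by simp), hAB (by simp)⟩

omit [Complementation c] in
theorem not_dichoOn_of_memOn {J : Finset ι} {x : ι → Set S} (hx : Transversal c x) {u v : ι → S}
    (hu : MemOn J x u) (hv : MemOn J x v) : ¬ DichoOn c J u v := by
  rintro ⟨j, hj, h⟩
  have := (compl_mem_iff (hx j) (u j)).1 (h ▸ hv j hj)
  exact this (hu j hj)

omit [Complementation c] in
theorem TwinFree.eq_of_memOn {J : Finset ι} {V : Finset (ι → S)} (hV : TwinFree c J V)
    {x : ι → Set S} (hx : Transversal c x) {u v : ι → S} (hu : u ∈ V) (hv : v ∈ V)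
    (hxu : MemOn J x u) (hxv : MemOn J x v) : u = v := by
  by_contra h
  exact not_dichoOn_of_memOn hx hxu hxv (hV.dich u hu v hv h)

/-- A common point of two non-dichotomous words. -/
theorem exists_common_point {J : Finset ι} {u v : ι → S} (h : ¬ DichoOn c J u v) :
    ∃ x, Transversal c x ∧ MemOn J x u ∧ MemOn J x v := by
  obtain ⟨x, hx, hA⟩ := exists_transversal (c := c) (fun j => {s | j ∈ J ∧ (s = u j ∨ s = v j)}) (by
    rintro i s ⟨hi, hs⟩ ⟨-, hs'⟩
    have h1 := Complementation.ne (c := c) s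
    have h2 := Complementation.invol (c := c) s
    rcases hs with rfl | rfl <;> rcases hs' with hs' | hs'
    · exact h1 hs'
    · exact h ⟨i, hi, hs'.symm⟩
    · exact h ⟨i, hi, by rw [← hs', h2]⟩
    · exact h1 hs')
  exact ⟨x, hx, fun j hj => hA j ⟨hj, Or.inl rfl⟩, fun j hj => hA j ⟨hj, Or.inr rfl⟩⟩

/-- If the part of `a` in the box of `w` lies in `b`, every letter of `b` comes from `a` or `w`. -/
theorem eq_or_eq_of_subset {J : Finset ι} {a b w : ι → S} (h : ¬ DichoOn c J a w)
    (hab : ∀ x, Transversal c x → MemOn J x w → MemOn J x a → MemOn J x b) {m : ι} (hm : m ∈ J) :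
    b m = a m ∨ b m = w m := by
  by_contra! hne
  obtain ⟨x, hx, hxa, hxw⟩ := exists_common_point h
  obtain ⟨B, hB, hAB⟩ := exists_eSet_superset (c := c) {a m, w m, c (b m)} (by
    have h1 := Complementation.ne (c := c)
    have h2 := Complementation.invol (c := c)
    have h3 : w m ≠ c (a m) := fun h' => h ⟨m, hm, h'⟩
    have h4 : a m ≠ c (w m) := fun h' => h3 (by rw [h', h2])
    have h5 : ∀ s t, c s = c t → s = t := fun s t hst => by rw [← h2 s, hst, h2]
    rintro s (rfl | rfl | rfl) <;>
      simp only [Set.mem_insert_iff, Set.mem_singleton_iff, h2, not_or]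
    · exact ⟨h1 _, fun h' => h3 h'.symm, fun h' => hne.1 (h5 _ _ h').symm⟩
    · exact ⟨fun h' => h4 h'.symm, h1 _, fun h' => hne.2 (h5 _ _ h').symm⟩
    · exact ⟨hne.1, hne.2, (h1 _).symm⟩)
  have hmem : ∀ v, v m ∈ B → MemOn J x v → MemOn J (Function.update x m B) v := fun v hv hxv =>
    (memOn_update_iff hm).2 ⟨hv, hxv.mono (Finset.erase_subset _ _)⟩
  have := hab _ (transversal_update hx m hB) (hmem w (hAB (by simp)) hxw)
    (hmem a (hAB (by simp)) hxa)
  have h1 : b m ∈ B := ((memOn_update_iff hm).1 this).1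
  exact (compl_mem_iff hB (b m)).1 (hAB (by simp)) h1

theorem agreeOn_of_box_eq {J : Finset ι} {a b w : ι → S} (ha : ¬ DichoOn c J a w)
    (hb : ¬ DichoOn c J b w)
    (hab : ∀ x, Transversal c x → MemOn J x w → (MemOn J x a ↔ MemOn J x b)) : AgreeOn J a b := by
  intro m hm
  have h1 := eq_or_eq_of_subset ha (fun x hx hw h => (hab x hx hw).1 h) hm
  have h2 := eq_or_eq_of_subset hb (fun x hx hw h => (hab x hx hw).2 h) hm
  rcases h1 with h1 | h1 <;> rcases h2 with h2 | h2 <;> simp_all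

theorem TwinFree.sl {J : Finset ι} {V : Finset (ι → S)} (hV : TwinFree c J V) (i : ι) (l : S) :
    TwinFree c (J.erase i) (sl V i l) := by
  refine ⟨fun u hu v hv huv => ?_, fun u hu v hv => ?_⟩
  · rw [mem_sl] at hu hv
    obtain ⟨j, hj, h⟩ := hV.dich u hu.1 v hv.1 huv
    refine ⟨j, Finset.mem_erase.2 ⟨?_, hj⟩, h⟩
    rintro rfl
    rw [hu.2, hv.2] at h
    exact Complementation.ne (c := c) l h.symm
  · rw [mem_sl] at hu hv
    rintro ⟨j, hj, h, h'⟩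
    refine hV.twin u hu.1 v hv.1 ⟨j, Finset.mem_of_mem_erase hj, h, fun k hk hkj => ?_⟩
    by_cases hki : k = i
    · rw [hki, hu.2, hv.2]
    · exact h' k (Finset.mem_erase.2 ⟨hki, hk⟩) hkj

omit [Complementation c] in
/-- Words with complementary letters at `i` that agree elsewhere would be twins. -/
theorem TwinFree.not_agreeOn {J : Finset ι} {V : Finset (ι → S)} (hV : TwinFree c J V) {i : ι}
    (hi : i ∈ J) {u v : ι → S} (hu : u ∈ V) (hv : v ∈ V) (h : v i = c (u i)) :
    ¬ AgreeOn (J.erase i) u v := fun h' =>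
  hV.twin u hu v hv ⟨i, hi, h, fun k hk hki => (h' k (Finset.mem_erase.2 ⟨hki, hk⟩)).symm⟩

end Basic

section Cover

variable {ι : Type} {c : S → S}

/-- The point `x` is covered by the words of `D`, over the positions in `J`. -/
def Cov (J : Finset ι) (D : Finset (ι → S)) (x : ι → Set S) : Prop := ∃ d ∈ D, MemOn J x d

/-- The words of `D` that meet `w` over the positions in `J`. -/
noncomputable def meeting (c : S → S) (J : Finset ι) (D : Finset (ι → S)) (w : ι → S) :
    Finset (ι → S) :=
  D.filter (fun d => ¬ DichoOn c J d w)

/-- `C` and `D` cover the same points of the box of `w`. -/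
def EqvOn (c : S → S) (J : Finset ι) (C D : Finset (ι → S)) (w : ι → S) : Prop :=
  ∀ x, Transversal c x → MemOn J x w → (Cov J C x ↔ Cov J D x)

theorem EqvOn.symm {J : Finset ι} {C D : Finset (ι → S)} {w : ι → S} (h : EqvOn c J C D w) :
    EqvOn c J D C w := fun x hx hw => (h x hx hw).symm

theorem mem_meeting {J : Finset ι} {D : Finset (ι → S)} {w d : ι → S} :
    d ∈ meeting c J D w ↔ d ∈ D ∧ ¬ DichoOn c J d w := by
  simp [meeting]

theorem meeting_subset (J : Finset ι) (D : Finset (ι → S)) (w : ι → S) :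
    meeting c J D w ⊆ D := Finset.filter_subset _ _

theorem cov_meeting {J : Finset ι} {D : Finset (ι → S)} {w : ι → S} {x : ι → Set S}
    (hx : Transversal c x) (hw : MemOn J x w) : Cov J (meeting c J D w) x ↔ Cov J D x := by
  constructor
  · rintro ⟨d, hd, h⟩
    exact ⟨d, (mem_meeting.1 hd).1, h⟩
  · rintro ⟨d, hd, h⟩
    exact ⟨d, mem_meeting.2 ⟨hd, not_dichoOn_of_memOn hx h hw⟩, h⟩

theorem sl_card_add_le {V : Finset (ι → S)} {i : ι} {l m : S} (h : l ≠ m) :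
    (sl V i l).card + (sl V i m).card ≤ V.card := by
  rw [← Finset.card_union_of_disjoint]
  · exact Finset.card_le_card (Finset.union_subset (sl_subset _ _ _) (sl_subset _ _ _))
  · rw [Finset.disjoint_left]
    intro v h1 h2
    rw [mem_sl] at h1 h2
    exact h (h1.2.symm.trans h2.2)

theorem mem_sl_or_of_card_le {V : Finset (ι → S)} {i : ι} {l m : S} (h : l ≠ m)
    (hc : V.card ≤ (sl V i l).card + (sl V i m).card) {v : ι → S} (hv : v ∈ V) :
    v i = l ∨ v i = m := by
  have h1 : (sl V i l ∪ sl V i m).card = (sl V i l).card + (sl V i m).card := by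
    rw [Finset.card_union_of_disjoint]
    rw [Finset.disjoint_left]
    intro v h1 h2
    rw [mem_sl] at h1 h2
    exact h (h1.2.symm.trans h2.2)
  have h2 := Finset.eq_of_subset_of_card_le
    (Finset.union_subset (sl_subset V i l) (sl_subset V i m)) (by omega)
  rw [← h2, Finset.mem_union, mem_sl, mem_sl] at hv
  tauto

variable [Complementation c]

theorem compl_ne_compl {s t : S} (h : s ≠ t) : c s ≠ c t := fun h' =>
  h (by rw [← Complementation.invol (c := c) s, h', Complementation.invol (c := c)])

theorem ne_compl_symm {s t : S} (h : s ≠ c t) : t ≠ c s := fun h' =>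
  h (by rw [h', Complementation.invol (c := c)])

theorem not_dichoOn_self (J : Finset ι) (w : ι → S) : ¬ DichoOn c J w w := by
  rintro ⟨j, -, h⟩
  exact Complementation.ne (c := c) _ h.symm

/-- Codes without twin pairs cover no box nontrivially with fewer than five words. -/
def CoverBound (c : S → S) (J : Finset ι) : Prop :=
  ∀ (D : Finset (ι → S)) (w : ι → S), TwinFree c J D →
    (∀ x, Transversal c x → MemOn J x w → Cov J D x) → (∀ d ∈ D, ¬ AgreeOn J d w) → 5 ≤ D.card

theorem local_bound_of_coverBound {K : Finset ι} (hK : ∀ J ⊆ K, CoverBound c J)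
    {D : Finset (ι → S)} {u w : ι → S} (hD : TwinFree c K D) (huw : ¬ DichoOn c K u w)
    (hcov : ∀ x, Transversal c x → MemOn K x w → (Cov K D x ↔ MemOn K x u))
    (hne : ∀ d ∈ D, ¬ AgreeOn K d u) : 5 ≤ (meeting c K D w).card := by
  set E := meeting c K D w with hE
  have hED : E ⊆ D := meeting_subset _ _ _
  have hoff : ∀ d ∈ E, ∀ m ∈ K, u m ≠ w m → d m = u m := by
    intro d hd m hm hmne
    have hd' := mem_meeting.1 hd
    rcases eq_or_eq_of_subset hd'.2
      (fun x hx hw h => (hcov x hx hw).1 ⟨d, hd'.1, h⟩) hm with h | h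
    · exact h.symm
    · exact absurd h hmne
  refine hK (K.filter (fun j => u j = w j)) (Finset.filter_subset _ _) E u ⟨?_, ?_⟩ ?_ ?_
  · intro a ha b hb hab
    obtain ⟨j, hj, h⟩ := hD.dich a (hED ha) b (hED hb) hab
    refine ⟨j, Finset.mem_filter.2 ⟨hj, ?_⟩, h⟩
    by_contra hne
    rw [hoff a ha j hj hne, hoff b hb j hj hne] at h
    exact Complementation.ne (c := c) _ h.symm
  · rintro a ha b hb ⟨j, hj, h, h'⟩
    refine hD.twin a (hED ha) b (hED hb) ⟨j, (Finset.mem_filter.1 hj).1, h, fun m hm hmj => ?_⟩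
    by_cases hmw : u m = w m
    · exact h' m (Finset.mem_filter.2 ⟨hm, hmw⟩) hmj
    · rw [hoff a ha m hm hmw, hoff b hb m hm hmw]
  · intro x hx hxu
    obtain ⟨y, hy, hyu, hyw⟩ := exists_common_point huw
    have hz : Transversal c (fun j => if u j = w j then x j else y j) := by
      intro j
      dsimp only
      split_ifs
      exacts [hx j, hy j]
    have hzu : MemOn K (fun j => if u j = w j then x j else y j) u := by
      intro j hj
      dsimp only
      split_ifs with h
      exacts [hxu j (Finset.mem_filter.2 ⟨hj, h⟩), hyu j hj]
    have hzw : MemOn K (fun j => if u j = w j then x j else y j) w := by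
      intro j hj
      dsimp only
      split_ifs with h
      exacts [h ▸ hxu j (Finset.mem_filter.2 ⟨hj, h⟩), hyw j hj]
    obtain ⟨d, hd, hzd⟩ := (cov_meeting hz hzw).2 ((hcov _ hz hzw).2 hzu)
    refine ⟨d, hd, fun j hj => ?_⟩
    have := hzd j (Finset.mem_filter.1 hj).1
    simpa [(Finset.mem_filter.1 hj).2] using this
  · intro d hd hag
    refine hne d (hED hd) fun m hm => ?_
    by_cases hmw : u m = w m
    · exact hag m (Finset.mem_filter.2 ⟨hm, hmw⟩)
    · exact hoff d hd m hm hmw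

/-- If the fibres of `D` over a letter `s` and its complement can be compared through `w`,
they cover the same part of the box of `w`. -/
theorem exists_compl_of_cov {J : Finset ι} {D : Finset (ι → S)} (hD : TwinFree c J D)
    {w : ι → S} (hcov : ∀ x, Transversal c x → MemOn J x w → Cov J D x) {j : ι} (hj : j ∈ J)
    {s : S} (hs : w j ≠ s) {x : ι → Set S} (hx : Transversal c x) (hxw : MemOn (J.erase j) x w)
    (h : Cov (J.erase j) (sl D j s) x) : Cov (J.erase j) (sl D j (c s)) x := by
  obtain ⟨d, hd, hxd⟩ := h
  rw [mem_sl] at hd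
  obtain ⟨B, hB, hB1, hB2⟩ := exists_eSet_pair (c := c) (s := w j) (t := c s)
    (compl_ne_compl hs.symm)
  obtain ⟨e, he, hxe⟩ := hcov _ (transversal_update hx j hB) ((memOn_update_iff hj).2 ⟨hB1, hxw⟩)
  rw [memOn_update_iff hj] at hxe
  have hde : d ≠ e := by
    rintro rfl
    exact (compl_mem_iff hB s).1 hB2 (hd.2 ▸ hxe.1)
  obtain ⟨k, hk, hke⟩ := hD.dich d hd.1 e he hde
  by_cases hkj : k = j
  · subst hkj
    exact ⟨e, mem_sl.2 ⟨he, by rw [hke, hd.2]⟩, hxe.2⟩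
  · exact absurd ⟨k, Finset.mem_erase.2 ⟨hkj, hk⟩, hke⟩ (not_dichoOn_of_memOn hx hxd hxe.2)

theorem coverBound (J : Finset ι) : CoverBound c J := by
  induction J using Finset.strongInduction with
  | H J ih =>
  intro D₀ w hD₀ hcov₀ hne₀
  set D := meeting c J D₀ w with hDdef
  have hsub : D ⊆ D₀ := meeting_subset _ _ _
  have hmeet : ∀ d ∈ D, ¬ DichoOn c J d w := fun d hd => (mem_meeting.1 hd).2
  have hD : TwinFree c J D := hD₀.mono hsub
  have hcov : ∀ x, Transversal c x → MemOn J x w → Cov J D x := fun x hx hw =>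
    (cov_meeting hx hw).2 (hcov₀ x hx hw)
  refine le_trans ?_ (Finset.card_le_card hsub)
  obtain ⟨x, hx, hxw, -⟩ := exists_common_point (not_dichoOn_self (c := c) J w)
  obtain ⟨d, hd, hxd⟩ := hcov x hx hxw
  have hdw := hne₀ d (hsub hd)
  simp only [AgreeOn, not_forall] at hdw
  obtain ⟨j, hj, hdj⟩ := hdw
  have hjw : d j ≠ c (w j) := ne_compl_symm fun h => hmeet d hd ⟨j, hj, h⟩
  have hKJ : J.erase j ⊂ J := Finset.erase_ssubset hj
  have hs1 : ∀ y, Transversal c y → MemOn (J.erase j) y w →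
      (Cov (J.erase j) (sl D j (d j)) y ↔ Cov (J.erase j) (sl D j (c (d j))) y) := by
    intro y hy hyw
    refine ⟨exists_compl_of_cov hD hcov hj (fun h => hdj h.symm) hy hyw, fun h => ?_⟩
    have := exists_compl_of_cov hD hcov hj (ne_compl_symm hjw) hy hyw h
    rwa [Complementation.invol (c := c)] at this
  have hds : d ∈ sl D j (d j) := mem_sl.2 ⟨hd, rfl⟩
  obtain ⟨e, he, hxe⟩ := (hs1 x hx (hxw.mono hKJ.subset)).1
    ⟨d, hds, hxd.mono hKJ.subset⟩
  have hle := sl_card_add_le (V := D) (i := j) (Complementation.ne (c := c) (d j)).symm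
  have hle5 : ∀ l m, (∀ y, Transversal c y → MemOn (J.erase j) y w →
      (Cov (J.erase j) (sl D j l) y ↔ Cov (J.erase j) (sl D j m) y)) → m = c l →
      ∀ p, sl D j l = {p} → 5 ≤ (sl D j m).card := by
    intro l m hlm hml p hp
    have hpl : p ∈ sl D j l := by rw [hp]; simp
    rw [mem_sl] at hpl
    refine le_trans (local_bound_of_coverBound
      (fun J' hJ' => ih J' (lt_of_le_of_lt hJ' hKJ)) (hD.sl j m) (u := p) (w := w)
      (fun h => hmeet p hpl.1 (h.mono hKJ.subset)) (fun y hy hyw => ?_) (fun a ha hag => ?_))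
      (Finset.card_le_card (meeting_subset (c := c) _ _ _))
    · rw [← hlm y hy hyw, hp]
      simp [Cov]
    · rw [mem_sl] at ha
      exact hD.not_agreeOn hj hpl.1 ha.1 (by rw [ha.2, hpl.2, hml]) hag.symm
  have h1 : 0 < (sl D j (d j)).card := Finset.card_pos.2 ⟨d, hds⟩
  have h2 : 0 < (sl D j (c (d j))).card := Finset.card_pos.2 ⟨e, he⟩
  rcases Nat.lt_or_ge (sl D j (d j)).card 2 with h3 | h3
  · obtain ⟨p, hp⟩ := Finset.card_eq_one.1 (by omega : (sl D j (d j)).card = 1)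
    have := hle5 _ _ hs1 rfl p hp
    omega
  rcases Nat.lt_or_ge (sl D j (c (d j))).card 2 with h4 | h4
  · obtain ⟨p, hp⟩ := Finset.card_eq_one.1 (by omega : (sl D j (c (d j))).card = 1)
    have := hle5 _ _ (fun y hy hyw => (hs1 y hy hyw).symm)
      (Complementation.invol (c := c) _).symm p hp
    omega
  by_contra h5
  have hall : ∀ v ∈ D, v j = d j ∨ v j = c (d j) := fun v hv => mem_sl_or_of_card_le
    (V := D) (i := j) (Complementation.ne (c := c) (d j)).symm (by omega) hv
  by_cases hag : ∃ a ∈ sl D j (d j), AgreeOn (J.erase j) a w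
  · obtain ⟨a, ha, haw⟩ := hag
    obtain ⟨b, hb, hba⟩ := Finset.exists_mem_ne (s := sl D j (d j)) (by omega) a
    obtain ⟨k, hk, hkab⟩ := (hD.sl j (d j)).dich b hb a ha hba
    refine hmeet b (mem_sl.1 hb).1 ⟨k, Finset.mem_of_mem_erase hk, ?_⟩
    rw [← haw k hk, hkab]
  · push Not at hag
    have := ih _ hKJ (sl D j (d j)) w (hD.sl _ _) (fun y hy hyw => ?_) hag
    · omega
    · obtain ⟨B, hB, hB1, hB2⟩ := exists_eSet_pair (c := c) (s := w j) (t := d j) hjw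
      obtain ⟨a, ha, hya⟩ := hcov _ (transversal_update hy j hB)
        ((memOn_update_iff hj).2 ⟨hB1, hyw⟩)
      rw [memOn_update_iff hj] at hya
      refine ⟨a, mem_sl.2 ⟨ha, ?_⟩, hya.2⟩
      rcases hall a ha with h | h
      · exact h
      · exact absurd hB2 ((compl_mem_iff hB _).1 (h ▸ hya.1))

theorem local_bound {K : Finset ι} {D : Finset (ι → S)} {u w : ι → S} (hD : TwinFree c K D)
    (huw : ¬ DichoOn c K u w)
    (hcov : ∀ x, Transversal c x → MemOn K x w → (Cov K D x ↔ MemOn K x u))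
    (hne : ∀ d ∈ D, ¬ AgreeOn K d u) : 5 ≤ (meeting c K D w).card :=
  local_bound_of_coverBound (fun J _ => coverBound J) hD huw hcov hne

/-- A small code that coincides with a word `u` inside the box of `w` contains `u`. -/
theorem exists_agreeOn_of_card_le {K : Finset ι} {D : Finset (ι → S)} {u w : ι → S}
    (hD : TwinFree c K D) (huw : ¬ DichoOn c K u w)
    (hcov : ∀ x, Transversal c x → MemOn K x w → (Cov K D x ↔ MemOn K x u))
    (hcard : (meeting c K D w).card ≤ 4) :
    ∃ d ∈ D, AgreeOn K d u ∧ ∀ e ∈ D, ¬ DichoOn c K e w → e = d := by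
  by_contra! h
  by_cases hne : ∀ d ∈ D, ¬ AgreeOn K d u
  · have := local_bound hD huw hcov hne
    omega
  · push Not at hne
    obtain ⟨d, hd, hdu⟩ := hne
    obtain ⟨e, he, hew, hed⟩ := h d hd hdu
    obtain ⟨x, hx, hxe, hxw⟩ := exists_common_point hew
    have hxd : MemOn K x d := hdu.symm.mem ((hcov x hx hxw).1 ⟨e, he, hxe⟩)
    exact hed (hD.eq_of_memOn hx he hd hxe hxd)

theorem EqvOn.card_meeting {K : Finset ι} {C D : Finset (ι → S)} {w : ι → S}
    (h : EqvOn c K C D w) (hC : TwinFree c K C) (hD : TwinFree c K D)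
    (hne : ∀ a ∈ C, ∀ b ∈ D, ¬ AgreeOn K a b) {a : ι → S} (ha : a ∈ C)
    (haw : ¬ DichoOn c K a w) :
    0 < (meeting c K C w).card ∧ 0 < (meeting c K D w).card ∧
    ((2 ≤ (meeting c K C w).card ∧ 2 ≤ (meeting c K D w).card) ∨
      5 ≤ (meeting c K C w).card ∨ 5 ≤ (meeting c K D w).card) := by
  have key : ∀ (C D : Finset (ι → S)), EqvOn c K C D w → TwinFree c K D →
      (∀ a ∈ C, ∀ b ∈ D, ¬ AgreeOn K a b) → (meeting c K C w).card = 1 →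
      5 ≤ (meeting c K D w).card := by
    intro C D h hD hne h1
    obtain ⟨p, hp⟩ := Finset.card_eq_one.1 h1
    have hpm : p ∈ meeting c K C w := by rw [hp]; simp
    rw [mem_meeting] at hpm
    refine local_bound hD hpm.2 (fun x hx hw => ?_) (fun d hd hdp => hne p hpm.1 d hd hdp.symm)
    rw [← h x hx hw, ← cov_meeting hx hw, hp]
    simp [Cov]
  obtain ⟨x, hx, hxa, hxw⟩ := exists_common_point haw
  obtain ⟨b, hb, hxb⟩ := (h x hx hxw).1 ⟨a, ha, hxa⟩
  have h1 : 0 < (meeting c K C w).card :=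
    Finset.card_pos.2 ⟨a, mem_meeting.2 ⟨ha, haw⟩⟩
  have h2 : 0 < (meeting c K D w).card :=
    Finset.card_pos.2 ⟨b, mem_meeting.2 ⟨hb, not_dichoOn_of_memOn hx hxb hxw⟩⟩
  refine ⟨h1, h2, ?_⟩
  rcases Nat.lt_or_ge (meeting c K C w).card 2 with h3 | h3
  · exact Or.inr (Or.inr (key C D h hD hne (by omega)))
  rcases Nat.lt_or_ge (meeting c K D w).card 2 with h4 | h4
  · exact Or.inr (Or.inl (key D C h.symm hC
      (fun a ha b hb hab => hne b hb a ha hab.symm) (by omega)))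
  exact Or.inl ⟨h3, h4⟩

end Cover

section Rel

variable {ι : Type} {c : S → S}

/-- Two families of words cover every point equally often, over the positions in `J`. -/
def Rel (c : S → S) (J : Finset ι) (M N : Multiset (ι → S)) : Prop :=
  ∀ x, Transversal c x → M.countP (MemOn J x) = N.countP (MemOn J x)

theorem Rel.symm {J : Finset ι} {M N : Multiset (ι → S)} (h : Rel c J M N) : Rel c J N M :=
  fun x hx => (h x hx).symm

theorem compl_mem_eSet {B : Set S} (hB : B ∈ ESet c) : Bᶜ ∈ ESet c := fun s => by
  have := xor_def.1 (hB s)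
  refine xor_def.2 ?_
  simp only [Set.mem_compl_iff]
  tauto

theorem countP_update {J : Finset ι} {i : ι} (hi : i ∈ J) (x : ι → Set S) (B : Set S)
    (M : Multiset (ι → S)) : M.countP (MemOn J (Function.update x i B)) =
      (M.filter (fun v => v i ∈ B)).countP (MemOn (J.erase i) x) := by
  rw [Multiset.countP_filter]
  refine Multiset.countP_congr rfl fun v _ => ?_
  rw [memOn_update_iff hi, and_comm]

theorem Rel.slice {J : Finset ι} {M N : Multiset (ι → S)} (h : Rel c J M N) {i : ι} (hi : i ∈ J)
    {B : Set S} (hB : B ∈ ESet c) :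
    Rel c (J.erase i) (M.filter (fun v => v i ∈ B)) (N.filter (fun v => v i ∈ B)) := fun x hx => by
  rw [← countP_update hi, ← countP_update hi]
  exact h _ (transversal_update hx i hB)

theorem Rel.erase {J : Finset ι} {M N : Multiset (ι → S)} (h : Rel c J M N) {i : ι} (hi : i ∈ J) :
    Rel c (J.erase i) M N := fun x hx => by
  obtain ⟨B, hB, hmem⟩ : ∃ B ∈ ESet c, ∀ s, s ∈ B ↔ s ∉ x i :=
    ⟨(x i)ᶜ, compl_mem_eSet (hx i), fun s => Iff.rfl⟩
  have key : ∀ L : Multiset (ι → S), L.countP (MemOn (J.erase i) x) =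
      (L.filter (fun v => v i ∈ x i)).countP (MemOn (J.erase i) x) +
      (L.filter (fun v => v i ∈ B)).countP (MemOn (J.erase i) x) := fun L => by
    rw [Multiset.countP_eq_countP_filter_add _ _ (fun v => v i ∈ x i)]
    congr 2
    exact Multiset.filter_congr fun v _ => (hmem _).symm
  rw [key M, key N, h.slice hi (hx i) x hx, h.slice hi hB x hx]

variable [Complementation c]

theorem Rel.card_eq {J : Finset ι} {M N : Multiset (ι → S)} (h : Rel c J M N) :
    M.card = N.card := by
  induction J using Finset.induction_on with
  | empty =>
    obtain ⟨x, hx, -⟩ := exists_transversal (c := c) (fun _ : ι => (∅ : Set S)) (by simp)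
    have key : ∀ L : Multiset (ι → S), L.countP (MemOn ∅ x) = L.card := fun L =>
      Multiset.countP_eq_card.2 (fun v _ j hj => absurd hj (Finset.notMem_empty j))
    rw [← key M, ← key N, h x hx]
  | insert i J hi ih =>
    have := h.erase (Finset.mem_insert_self i J)
    rw [Finset.erase_insert hi] at this
    exact ih this

theorem swap_mem_eSet {B : Set S} (hB : B ∈ ESet c) {l : S} (hl : l ∈ B) :
    {s | s = c l ∨ (s ∈ B ∧ s ≠ l)} ∈ ESet c := fun s => by
  have h1 := compl_mem_iff hB s
  have h2 := compl_mem_iff hB l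
  have h3 : c s = l ↔ s = c l :=
    ⟨fun h => by rw [← h, Complementation.invol (c := c)],
      fun h => by rw [h, Complementation.invol (c := c)]⟩
  have h4 : c s = c l ↔ s = l :=
    ⟨fun h => by rw [← Complementation.invol (c := c) s, h, Complementation.invol (c := c)],
      fun h => by rw [h]⟩
  have h5 : s = c l → s ≠ l := fun h h' => Complementation.ne (c := c) l (by rw [← h, h'])
  have h6 : s = c l → s ∉ B := fun h => h ▸ fun h' => h2.1 h' hl
  have h7 : s = l → s ∈ B := fun h => h ▸ hl
  refine xor_def.2 ?_
  simp only [Set.mem_ofPred_eq, h4]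
  tauto

theorem Rel.letter {J : Finset ι} {M N : Multiset (ι → S)} (h : Rel c J M N) {i : ι} (hi : i ∈ J)
    (l : S) : Rel c (J.erase i)
      (M.filter (fun v => v i = l) + N.filter (fun v => v i = c l))
      (N.filter (fun v => v i = l) + M.filter (fun v => v i = c l)) := fun x hx => by
  obtain ⟨B, hB, hl⟩ := exists_eSet_superset (c := c) {l} (by
    rintro s rfl
    exact Complementation.ne (c := c) s)
  replace hl : l ∈ B := hl rfl
  have h1 := h.slice hi hB x hx
  obtain ⟨B', hB', hmem⟩ : ∃ B' ∈ ESet c, ∀ s, s ∈ B' ↔ s = c l ∨ (s ∈ B ∧ s ≠ l) :=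
    ⟨_, swap_mem_eSet hB hl, fun s => Iff.rfl⟩
  have h2 := h.slice hi hB' x hx
  have hcl : c l ∉ B := fun h' => (compl_mem_iff hB l).1 h' hl
  have k1 : ∀ L : Multiset (ι → S), (L.filter (fun v => v i ∈ B)).countP (MemOn (J.erase i) x) =
      (L.filter (fun v => v i = l)).countP (MemOn (J.erase i) x) +
      (L.filter (fun v => v i ∈ B ∧ v i ≠ l)).countP (MemOn (J.erase i) x) := fun L => by
    rw [Multiset.countP_eq_countP_filter_add _ _ (fun v => v i = l), Multiset.filter_filter,
      Multiset.filter_filter]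
    congr 2 <;> refine Multiset.filter_congr fun v _ => ?_
    · exact ⟨fun h => h.1, fun h => ⟨h, h ▸ hl⟩⟩
    · tauto
  have k2 : ∀ L : Multiset (ι → S), (L.filter (fun v => v i ∈ B')).countP (MemOn (J.erase i) x) =
      (L.filter (fun v => v i = c l)).countP (MemOn (J.erase i) x) +
      (L.filter (fun v => v i ∈ B ∧ v i ≠ l)).countP (MemOn (J.erase i) x) := fun L => by
    rw [Multiset.countP_eq_countP_filter_add _ _ (fun v => v i = c l), Multiset.filter_filter,
      Multiset.filter_filter]
    congr 2 <;> refine Multiset.filter_congr fun v _ => ?_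
    · exact ⟨fun h => h.1, fun h => ⟨h, (hmem _).2 (Or.inl h)⟩⟩
    · rw [hmem]
      constructor
      · rintro ⟨h, h' | h'⟩
        · exact absurd h' h
        · exact h'
      · rintro h'
        exact ⟨fun h => hcl (h ▸ h'.1), Or.inr h'⟩
  rw [k1, k1] at h1
  rw [k2, k2] at h2
  rw [Multiset.countP_add, Multiset.countP_add]
  omega

omit [Complementation c] in
theorem cov_iff_countP {J : Finset ι} {D : Finset (ι → S)} {x : ι → Set S} :
    Cov J D x ↔ 0 < D.val.countP (MemOn J x) := by
  rw [Multiset.countP_pos]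
  rfl

omit [Complementation c] in
theorem TwinFree.countP_le_one {J : Finset ι} {D : Finset (ι → S)} (hD : TwinFree c J D)
    {x : ι → Set S} (hx : Transversal c x) : D.val.countP (MemOn J x) ≤ 1 := by
  rw [Multiset.countP_eq_card_filter]
  change (D.filter (MemOn J x)).card ≤ 1
  rw [Finset.card_le_one]
  intro a ha b hb
  rw [Finset.mem_filter] at ha hb
  exact hD.eq_of_memOn hx ha.1 hb.1 ha.2 hb.2

omit [Complementation c] in
theorem Sys.rel {J : Finset ι} {V W : Finset (ι → S)} (h : Sys c J V W) :
    Rel c J V.val W.val := fun x hx => by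
  have h1 := h.eqv x hx
  change Cov J V x ↔ Cov J W x at h1
  rw [cov_iff_countP, cov_iff_countP] at h1
  have h2 := h.left.countP_le_one hx
  have h3 := h.right.countP_le_one hx
  omega

omit [Complementation c] in
theorem Rel.sys {J : Finset ι} {V W : Finset (ι → S)} (h : Rel c J V.val W.val)
    (hV : TwinFree c J V) (hW : TwinFree c J W) (hd : ∀ v ∈ V, ∀ w ∈ W, ¬ AgreeOn J v w) :
    Sys c J V W :=
  ⟨hV, hW, hd, fun x hx => by
    change Cov J V x ↔ Cov J W x
    rw [cov_iff_countP, cov_iff_countP, h x hx]⟩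

omit [Complementation c] in
theorem sl_val (V : Finset (ι → S)) (i : ι) (l : S) :
    (sl V i l).val = V.val.filter (fun v => v i = l) := rfl

theorem Sys.card_eq {J : Finset ι} {V W : Finset (ι → S)} (h : Sys c J V W) :
    V.card = W.card := h.rel.card_eq

theorem Sys.rel_sl {J : Finset ι} {V W : Finset (ι → S)} (h : Sys c J V W) {i : ι} (hi : i ∈ J)
    (l : S) : Rel c (J.erase i) ((sl V i l).val + (sl W i (c l)).val)
      ((sl W i l).val + (sl V i (c l)).val) := h.rel.letter hi l

/-- The number of words of `V` with the property `p`. -/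
noncomputable def num (V : Finset (ι → S)) (p : (ι → S) → Prop) : ℕ := (V.filter p).card

omit [Complementation c] in
theorem num_add_num (V : Finset (ι → S)) (p q : (ι → S) → Prop) :
    num V (fun v => p v ∧ q v) + num V (fun v => p v ∧ ¬ q v) = num V p := by
  have := Finset.card_filter_add_card_filter_not (s := V.filter p) q
  rw [Finset.filter_filter, Finset.filter_filter] at this
  unfold num
  convert this

omit [Complementation c] in
theorem num_congr {V : Finset (ι → S)} {p q : (ι → S) → Prop} (h : ∀ v ∈ V, p v ↔ q v) :
    num V p = num V q := by
  unfold num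
  rw [Finset.filter_congr h]

omit [Complementation c] in
theorem num_mono {V : Finset (ι → S)} {p q : (ι → S) → Prop} (h : ∀ v ∈ V, p v → q v) :
    num V p ≤ num V q :=
  Finset.card_le_card fun v hv => by
    rw [Finset.mem_filter] at hv ⊢
    exact ⟨hv.1, h v hv.1 hv.2⟩

omit [Complementation c] in
theorem num_pos {V : Finset (ι → S)} {p : (ι → S) → Prop} {v : ι → S} (hv : v ∈ V) (h : p v) :
    0 < num V p := Finset.card_pos.2 ⟨v, Finset.mem_filter.2 ⟨hv, h⟩⟩

omit [Complementation c] in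
theorem num_compl (V : Finset (ι → S)) (p : (ι → S) → Prop) :
    num V p + num V (fun v => ¬ p v) = V.card := by
  have := Finset.card_filter_add_card_filter_not (s := V) p
  unfold num
  convert this

theorem num_samePair (V : Finset (ι → S)) (p : (ι → S) → Prop) (i : ι) (l : S) :
    num V (fun v => p v ∧ SamePair c (v i) l) =
      num (sl V i l) p + num (sl V i (c l)) p := by
  unfold num sl
  rw [Finset.filter_filter, Finset.filter_filter, ← Finset.card_union_of_disjoint]
  · congr 1
    ext v
    simp only [Finset.mem_filter, Finset.mem_union]
    unfold SamePair
    tauto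
  · rw [Finset.disjoint_left]
    intro v h1 h2
    rw [Finset.mem_filter] at h1 h2
    exact Complementation.ne (c := c) l (h2.2.1.symm.trans h1.2.1)

theorem num_samePair' (V : Finset (ι → S)) (i : ι) (l : S) :
    num V (fun v => SamePair c (v i) l) = (sl V i l).card + (sl V i (c l)).card := by
  have := num_samePair (c := c) V (fun _ => True) i l
  simpa [num] using this

theorem Sys.even_num {J : Finset ι} {V W : Finset (ι → S)} (h : Sys c J V W) {i : ι} (hi : i ∈ J)
    (l : S) : Even (num V (fun v => SamePair c (v i) l) + num W (fun v => SamePair c (v i) l)) := by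
  have := (h.rel_sl hi l).card_eq
  rw [Multiset.card_add, Multiset.card_add] at this
  simp only [Finset.card_val] at this
  rw [num_samePair', num_samePair', Nat.even_iff]
  omega

theorem num_samePair_and (U : Finset (ι → S)) (i m : ι) (l e : S) :
    num U (fun v => SamePair c (v i) l ∧ SamePair c (v m) e) =
      (sl (sl U i l) m e).card + (sl (sl U i l) m (c e)).card +
      ((sl (sl U i (c l)) m e).card + (sl (sl U i (c l)) m (c e)).card) := by
  have h1 : num U (fun v => SamePair c (v i) l ∧ SamePair c (v m) e) =
      num U (fun v => SamePair c (v m) e ∧ SamePair c (v i) l) :=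
    num_congr fun v _ => and_comm
  rw [h1, num_samePair, num_samePair', num_samePair']

theorem Sys.even_num_and {J : Finset ι} {V W : Finset (ι → S)} (h : Sys c J V W) {i j : ι}
    (hi : i ∈ J) (hj : j ∈ J) (hij : j ≠ i) (l b : S) :
    Even (num V (fun v => SamePair c (v i) l ∧ SamePair c (v j) b) +
      num W (fun v => SamePair c (v i) l ∧ SamePair c (v j) b)) := by
  have := ((h.rel_sl hi l).letter (Finset.mem_erase.2 ⟨hij, hj⟩) b).card_eq
  simp only [Multiset.card_add, Multiset.filter_add] at this
  simp only [← sl_val, Finset.card_val] at this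
  rw [num_samePair_and, num_samePair_and, Nat.even_iff]
  omega

end Rel

section Crossing

variable {ι : Type} {c : S → S}

/-- A word of `V` with a letter from the pair of `l` at `i` meets, away from `i`, a word of `W`
with a letter from another pair at `i`. -/
def Cross (c : S → S) (J : Finset ι) (i : ι) (V W : Finset (ι → S)) (l : S) : Prop :=
  ∃ v ∈ V, ∃ w ∈ W, SamePair c (v i) l ∧ ¬ SamePair c (w i) l ∧ ¬ DichoOn c (J.erase i) v w

theorem samePair_self (a : S) : SamePair c a a := Or.inl rfl

theorem Sys.cov {J : Finset ι} {V W : Finset (ι → S)} (h : Sys c J V W) {x : ι → Set S}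
    (hx : Transversal c x) {w : ι → S} (hw : w ∈ W) (hxw : MemOn J x w) : Cov J V x :=
  (h.eqv x hx).2 ⟨w, hw, hxw⟩

variable [Complementation c]

theorem samePair_comm {a s : S} : SamePair c a s ↔ SamePair c s a :=
  ⟨samePair_symm, samePair_symm⟩

theorem compl_samePair {a s : S} : SamePair c (c a) s ↔ SamePair c a s := by
  rw [samePair_comm, samePair_compl, samePair_comm]

theorem Sys.exists_compl {J : Finset ι} {V W : Finset (ι → S)} (h : Sys c J V W) {i : ι}
    (hi : i ∈ J) {l : S} {w : ι → S} (hw : w ∈ W) (hwl : w i ≠ l) {x : ι → Set S}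
    (hx : Transversal c x) (hxw : MemOn (J.erase i) x w) (hv : Cov (J.erase i) (sl V i l) x) :
    Cov (J.erase i) (sl V i (c l)) x :=
  exists_compl_of_cov h.left (fun _ hy hyw => h.cov hy hw hyw) hi hwl hx hxw hv

theorem Sys.eqvOn {J : Finset ι} {V W : Finset (ι → S)} (h : Sys c J V W) {i : ι}
    (hi : i ∈ J) {l : S} {w : ι → S} (hw : w ∈ W) (hwl : ¬ SamePair c (w i) l) :
    EqvOn c (J.erase i) (sl V i l) (sl V i (c l)) w := by
  intro x hx hxw
  refine ⟨h.exists_compl hi hw (fun h' => hwl (Or.inl h')) hx hxw, fun h' => ?_⟩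
  have := h.exists_compl hi hw (fun h' => hwl (Or.inr h')) hx hxw h'
  rwa [Complementation.invol (c := c)] at this

omit [Complementation c] in
theorem TwinFree.sl_not_agreeOn {J : Finset ι} {V : Finset (ι → S)} (hV : TwinFree c J V) {i : ι}
    (hi : i ∈ J) (l : S) :
    ∀ a ∈ Polybox.sl V i l, ∀ b ∈ Polybox.sl V i (c l), ¬ AgreeOn (J.erase i) a b := by
  intro a ha b hb
  rw [mem_sl] at ha hb
  exact hV.not_agreeOn hi ha.1 hb.1 (by rw [ha.2, hb.2])

omit [Complementation c] in
theorem Sys.sl_not_agreeOn {J : Finset ι} {V W : Finset (ι → S)} (h : Sys c J V W) (i : ι)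
    (l : S) : ∀ a ∈ sl V i l, ∀ b ∈ sl W i l, ¬ AgreeOn (J.erase i) a b := by
  intro a ha b hb hab
  rw [mem_sl] at ha hb
  refine h.disj a ha.1 b hb.1 fun j hj => ?_
  by_cases hji : j = i
  · rw [hji, ha.2, hb.2]
  · exact hab j (Finset.mem_erase.2 ⟨hji, hj⟩)

omit [Complementation c] in
theorem mem_sl_of_samePair {V : Finset (ι → S)} {i : ι} {l : S} {v : ι → S} (hv : v ∈ V)
    (h : SamePair c (v i) l) : v ∈ sl V i l ∨ v ∈ sl V i (c l) := by
  rw [mem_sl, mem_sl]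
  rcases h with h | h
  · exact Or.inl ⟨hv, h⟩
  · exact Or.inr ⟨hv, h⟩

theorem Sys.four_le_meeting {J : Finset ι} {V W : Finset (ι → S)} (h : Sys c J V W) {i : ι}
    (hi : i ∈ J) {l : S} {v w : ι → S} (hv : v ∈ V) (hvl : SamePair c (v i) l) (hw : w ∈ W)
    (hwl : ¬ SamePair c (w i) l) (hvw : ¬ DichoOn c (J.erase i) v w) :
    (∃ a ∈ sl V i l, ¬ DichoOn c (J.erase i) a w) ∧
    (∃ a ∈ sl V i (c l), ¬ DichoOn c (J.erase i) a w) ∧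
    ((2 ≤ (meeting c (J.erase i) (sl V i l) w).card ∧
        2 ≤ (meeting c (J.erase i) (sl V i (c l)) w).card) ∨
      5 ≤ (meeting c (J.erase i) (sl V i l) w).card ∨
      5 ≤ (meeting c (J.erase i) (sl V i (c l)) w).card) := by
  have hE := h.eqvOn hi hw hwl
  have hne := h.left.sl_not_agreeOn hi l
  have hex : ∀ D : Finset (ι → S), 0 < (meeting c (J.erase i) D w).card →
      ∃ a ∈ D, ¬ DichoOn c (J.erase i) a w := fun D hD => by
    obtain ⟨a, ha⟩ := Finset.card_pos.1 hD
    exact ⟨a, mem_meeting.1 ha⟩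
  rcases mem_sl_of_samePair hv hvl with hv' | hv'
  · obtain ⟨h1, h2, h3⟩ := hE.card_meeting (h.left.sl i l) (h.left.sl i _) hne hv' hvw
    exact ⟨hex _ h1, hex _ h2, h3⟩
  · obtain ⟨h1, h2, h3⟩ := hE.symm.card_meeting (h.left.sl i _) (h.left.sl i l)
      (fun a ha b hb hab => hne b hb a ha hab.symm) hv' hvw
    exact ⟨hex _ h2, hex _ h1, by tauto⟩

theorem Sys.four_le_num_and {J : Finset ι} {V W : Finset (ι → S)} (h : Sys c J V W) {i : ι}
    (hi : i ∈ J) {l : S} {v w : ι → S} (hv : v ∈ V) (hvl : SamePair c (v i) l) (hw : w ∈ W)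
    (hwl : ¬ SamePair c (w i) l) (hvw : ¬ DichoOn c (J.erase i) v w) :
    4 ≤ num V (fun u => ¬ DichoOn c (J.erase i) u w ∧ SamePair c (u i) l) := by
  obtain ⟨-, -, h3⟩ := h.four_le_meeting hi hv hvl hw hwl hvw
  rw [num_samePair]
  have : ∀ D, num D (fun u => ¬ DichoOn c (J.erase i) u w) =
      (meeting c (J.erase i) D w).card := fun D => by
    unfold num meeting
    congr!
  rw [this, this]
  omega

theorem Sys.four_le_num {J : Finset ι} {V W : Finset (ι → S)} (h : Sys c J V W) {i : ι}
    (hi : i ∈ J) {l : S} (hX : Cross c J i V W l) : 4 ≤ num V (fun v => SamePair c (v i) l) := by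
  obtain ⟨v, hv, w, hw, hvl, hwl, hvw⟩ := hX
  exact (h.four_le_num_and hi hv hvl hw hwl hvw).trans (num_mono fun _ _ h => h.2)

theorem Sys.cov_sl_of_not_cross {J : Finset ι} {V W : Finset (ι → S)} (h : Sys c J V W) {i : ι}
    (hi : i ∈ J) {l : S} (hX : ¬ Cross c J i V W l) {x : ι → Set S} (hx : Transversal c x)
    (hc : Cov (J.erase i) (sl V i l) x) : Cov (J.erase i) (sl W i l) x := by
  obtain ⟨v, hv, hxv⟩ := hc
  rw [mem_sl] at hv
  obtain ⟨B, hB, hl, -⟩ := exists_eSet_pair (c := c) (s := l) (t := l)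
    (Complementation.ne (c := c) l).symm
  obtain ⟨w, hw, hxw⟩ := h.symm.cov (transversal_update hx i hB) hv.1
    ((memOn_update_iff hi).2 ⟨hv.2 ▸ hl, hxv⟩)
  rw [memOn_update_iff hi] at hxw
  refine ⟨w, mem_sl.2 ⟨hw, ?_⟩, hxw.2⟩
  by_contra hwl
  refine hX ⟨v, hv.1, w, hw, Or.inl hv.2, ?_, not_dichoOn_of_memOn hx hxv hxw.2⟩
  rintro (h' | h')
  · exact hwl h'
  · exact (compl_mem_iff hB l).1 (h' ▸ hxw.1) hl

theorem Cross.compl {J : Finset ι} {V W : Finset (ι → S)} {i : ι} {l : S} :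
    Cross c J i V W (c l) ↔ Cross c J i V W l := by
  simp only [Cross, samePair_compl]

end Crossing

section Critical

variable {ι : Type} {c : S → S}

/-- A system with at most eleven words such that every system on fewer positions has at least
twelve words. -/
structure Crit (c : S → S) (J : Finset ι) (V W : Finset (ι → S)) : Prop extends Sys c J V W where
  nonempty : V.Nonempty
  card_le : V.card ≤ 11
  ih : ∀ J' ⊂ J, ∀ V' W', Sys c J' V' W' → V'.Nonempty → 12 ≤ V'.card

variable [Complementation c] {J : Finset ι} {V W : Finset (ι → S)}

theorem Crit.symm (h : Crit c J V W) : Crit c J W V where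
  toSys := h.toSys.symm
  nonempty := by
    rw [← Finset.card_pos, ← h.toSys.card_eq, Finset.card_pos]
    exact h.nonempty
  card_le := by
    rw [← h.toSys.card_eq]
    exact h.card_le
  ih := h.ih

omit [Complementation c] in
theorem Crit.not_rel (h : Crit c J V W) {J' : Finset ι} (hJ : J' ⊂ J) {C D : Finset (ι → S)}
    (hC : TwinFree c J' C) (hD : TwinFree c J' D) (hd : ∀ v ∈ C, ∀ w ∈ D, ¬ AgreeOn J' v w)
    (hne : C.Nonempty) (hcard : C.card ≤ 11) : ¬ Rel c J' C.val D.val := fun hr => by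
  have := h.ih J' hJ C D (hr.sys hC hD hd) hne
  omega

theorem Crit.cross_or_cross (h : Crit c J V W) {i : ι} (hi : i ∈ J) {l : S} {v : ι → S}
    (hv : v ∈ V) (hvl : SamePair c (v i) l) : Cross c J i V W l ∨ Cross c J i W V l := by
  by_contra! hX
  have key : ∀ m, ¬ Cross c J i V W m → ¬ Cross c J i W V m → v ∉ sl V i m := by
    intro m h1 h2 hvm
    have := h.ih (J.erase i) (Finset.erase_ssubset hi) (sl V i m) (sl W i m)
      ⟨h.left.sl i m, h.right.sl i m, h.sl_not_agreeOn i m, fun x hx =>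
        ⟨h.cov_sl_of_not_cross hi h1 hx, h.symm.cov_sl_of_not_cross hi h2 hx⟩⟩ ⟨v, hvm⟩
    have h3 := Finset.card_le_card (sl_subset V i m)
    have h4 := h.card_le
    omega
  rcases mem_sl_of_samePair hv hvl with hv' | hv'
  · exact key l hX.1 hX.2 hv'
  · exact key (c l) (by rw [Cross.compl]; exact hX.1) (by rw [Cross.compl]; exact hX.2) hv'

theorem five_le_card {K : Finset ι} {D : Finset (ι → S)} {w : ι → S} (hD : TwinFree c K D)
    (hcov : ∀ x, Transversal c x → MemOn K x w → Cov K D x) (hne : ∀ d ∈ D, ¬ AgreeOn K d w) :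
    5 ≤ D.card := coverBound K D w hD hcov hne

theorem Crit.six_le_card (h : Crit c J V W) {i : ι} (hi : i ∈ J) {l : S}
    (hT : sl W i l = ∅) (hQ : (sl W i (c l)).Nonempty) : 6 ≤ (sl V i (c l)).card := by
  have hrel := h.rel_sl hi l
  have hcard := hrel.card_eq
  rw [hT] at hrel hcard
  simp only [Multiset.card_add, Finset.card_val, zero_add, Finset.empty_val] at hrel hcard
  have hRT : TwinFree c (J.erase i) (sl V i (c l)) := h.left.sl i _
  have hu : ∀ u, u ∈ sl V i l ∨ u ∈ sl W i (c l) →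
      5 ≤ (meeting c (J.erase i) (sl V i (c l)) u).card := by
    intro u hu
    refine five_le_card (hRT.mono (meeting_subset _ _ _)) (w := u) (fun x hx hxu => ?_) ?_
    · rw [cov_meeting hx hxu, cov_iff_countP, ← hrel x hx, Multiset.countP_pos]
      refine ⟨u, ?_, hxu⟩
      rw [Multiset.mem_add]
      exact hu
    · intro d hd hdu
      have hd' := (mem_meeting.1 hd).1
      rcases hu with hu | hu
      · exact h.left.sl_not_agreeOn hi l u hu d hd' hdu.symm
      · exact h.sl_not_agreeOn i (c l) d hd' u hu hdu
  obtain ⟨q, hq⟩ := hQ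
  have h5 := (hu q (Or.inr hq)).trans (Finset.card_le_card (meeting_subset _ _ _))
  by_contra h6
  have hmeet : ∀ u, u ∈ sl V i l ∨ u ∈ sl W i (c l) → ∀ r ∈ sl V i (c l),
      ¬ DichoOn c (J.erase i) r u := by
    intro u hu' r hr
    have := Finset.eq_of_subset_of_card_le (meeting_subset (c := c) (J.erase i) (sl V i (c l)) u)
      (by have := hu u hu'; omega)
    rw [← this] at hr
    exact (mem_meeting.1 hr).2
  obtain ⟨r1, hr1⟩ := Finset.card_pos.1 (by omega : 0 < (sl V i (c l)).card)
  obtain ⟨r2, hr2, hr21⟩ := Finset.exists_mem_ne (s := sl V i (c l)) (by omega) r1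
  obtain ⟨j, hj, hj12⟩ := hRT.dich r1 hr1 r2 hr2 hr21.symm
  have hlet := hrel.letter hj (r1 j)
  have hnone : ∀ u, u ∈ sl V i l ∨ u ∈ sl W i (c l) → u j ≠ r1 j ∧ u j ≠ c (r1 j) := by
    intro u hu'
    refine ⟨fun h' => hmeet u hu' r2 hr2 (DichoOn.symm ⟨j, hj, ?_⟩),
      fun h' => hmeet u hu' r1 hr1 ⟨j, hj, h'⟩⟩
    rw [h', hj12]
  have hempty : ∀ m, (m = r1 j ∨ m = c (r1 j)) →
      ((sl V i l).val + (sl W i (c l)).val).filter (fun v => v j = m) = 0 := by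
    intro m hm
    rw [Multiset.filter_eq_nil]
    intro u hu' hum
    have := hnone u (Multiset.mem_add.1 hu')
    rcases hm with rfl | rfl
    · exact this.1 hum
    · exact this.2 hum
  rw [hempty _ (Or.inl rfl), hempty _ (Or.inr rfl), zero_add, add_zero] at hlet
  refine h.not_rel ?_ (hRT.sl j _) (hRT.sl j _) (hRT.sl_not_agreeOn hj (r1 j))
    ⟨r1, mem_sl.2 ⟨hr1, rfl⟩⟩ ?_ hlet.symm
  · exact lt_of_le_of_lt (Finset.erase_subset _ _) (Finset.erase_ssubset hi)
  · have := Finset.card_le_card (sl_subset (sl V i (c l)) j (r1 j))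
    omega

theorem Crit.twelve_le_num (h : Crit c J V W) {i : ι} (hi : i ∈ J) {l : S}
    (hX : Cross c J i V W l) (hY : ¬ Cross c J i W V l) :
    12 ≤ num V (fun v => SamePair c (v i) l) + num W (fun v => SamePair c (v i) l) := by
  have hcard := (h.rel_sl hi l).card_eq
  simp only [Multiset.card_add, Finset.card_val] at hcard
  have hVle := h.card_le
  have hPle := Finset.card_le_card (sl_subset V i l)
  rw [num_samePair', num_samePair']
  rcases Finset.eq_empty_or_nonempty (sl W i l) with hT | hT <;>
    rcases Finset.eq_empty_or_nonempty (sl W i (c l)) with hQ | hQ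
  · exfalso
    obtain ⟨v, hv, w, hw, hvl, hwl, hvw⟩ := hX
    obtain ⟨⟨a, ha, -⟩, -, -⟩ := h.four_le_meeting hi hv hvl hw hwl hvw
    have hrel := h.rel_sl hi l
    rw [hT, hQ] at hrel
    simp only [Finset.empty_val, zero_add, add_zero] at hrel
    exact h.not_rel (Finset.erase_ssubset hi) (h.left.sl i l) (h.left.sl i _)
      (h.left.sl_not_agreeOn hi l) ⟨a, ha⟩ (by omega) hrel
  · have h6 := h.six_le_card hi hT hQ
    rw [hT, Finset.card_empty] at hcard ⊢
    omega
  · have h6 := h.six_le_card hi (l := c l) hQ (by rwa [Complementation.invol (c := c)])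
    rw [Complementation.invol (c := c)] at h6
    rw [hQ, Finset.card_empty] at hcard ⊢
    omega
  · have key : ∀ m, ¬ Cross c J i W V m → (sl W i m).Nonempty → 5 ≤ (sl V i m).card := by
      rintro m hm ⟨t, ht⟩
      exact five_le_card (h.left.sl i m) (w := t)
        (fun x hx hxt => h.symm.cov_sl_of_not_cross hi hm hx ⟨t, ht, hxt⟩)
        (fun d hd => h.sl_not_agreeOn i m d hd t ht)
    have h1 := key l hY hT
    have h2 := key (c l) (by rwa [Cross.compl]) hQ
    have h3 := Finset.card_pos.2 hT
    have h4 := Finset.card_pos.2 hQ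
    omega

/-- The number of words of both codes with a letter from the pair of `l` at `i`. -/
noncomputable def total (c : S → S) (V W : Finset (ι → S)) (i : ι) (l : S) : ℕ :=
  num V (fun v => SamePair c (v i) l) + num W (fun v => SamePair c (v i) l)

theorem Crit.eight_le_total (h : Crit c J V W) {i : ι} (hi : i ∈ J) {l : S} {v : ι → S}
    (hv : v ∈ V) (hvl : SamePair c (v i) l) : 8 ≤ total c V W i l := by
  unfold total
  by_cases hX : Cross c J i V W l <;> by_cases hY : Cross c J i W V l
  · have h1 := h.four_le_num hi hX
    have h2 := h.symm.four_le_num hi hY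
    omega
  · have := h.twelve_le_num hi hX hY
    omega
  · have := h.symm.twelve_le_num hi hY hX
    omega
  · exact absurd (h.cross_or_cross hi hv hvl) (by tauto)

omit [Complementation c] in
theorem total_symm (i : ι) (l : S) : total c V W i l = total c W V i l := by
  unfold total
  omega

theorem Crit.eight_le_total' (h : Crit c J V W) {i : ι} (hi : i ∈ J) {l : S} {v : ι → S}
    (hv : v ∈ V ∨ v ∈ W) (hvl : SamePair c (v i) l) : 8 ≤ total c V W i l := by
  rcases hv with hv | hv
  · exact h.eight_le_total hi hv hvl
  · rw [total_symm]
    exact h.symm.eight_le_total hi hv hvl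

theorem num_add_num_le (U : Finset (ι → S)) (i : ι) {l r : S} (hlr : ¬ SamePair c l r) :
    num U (fun v => SamePair c (v i) l) + num U (fun v => SamePair c (v i) r) ≤ U.card := by
  rw [← num_compl U (fun v => SamePair c (v i) l)]
  exact Nat.add_le_add_left (num_mono fun v _ h1 h2 =>
    hlr (samePair_trans (samePair_symm h2) h1)) _

theorem num_add_num_add_num_le (U : Finset (ι → S)) (i : ι) {l r m : S} (hlr : ¬ SamePair c l r)
    (hlm : ¬ SamePair c l m) (hrm : ¬ SamePair c r m) :
    num U (fun v => SamePair c (v i) l) + num U (fun v => SamePair c (v i) r) +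
      num U (fun v => SamePair c (v i) m) ≤ U.card := by
  have h1 := num_compl U (fun v => SamePair c (v i) m)
  have h2 := num_add_num_le (U.filter (fun v => ¬ SamePair c (v i) m)) i hlr
  have h3 : ∀ s, ¬ SamePair c s m →
      num (U.filter (fun v => ¬ SamePair c (v i) m)) (fun v => SamePair c (v i) s) =
      num U (fun v => SamePair c (v i) s) := fun s hs => by
    unfold num
    rw [Finset.filter_filter]
    congr 1
    ext v
    simp only [Finset.mem_filter]
    constructor
    · rintro ⟨h, -, h'⟩
      exact ⟨h, h'⟩
    · rintro ⟨h, h'⟩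
      exact ⟨h, fun h'' => hs (samePair_trans (samePair_symm h') h''), h'⟩
  rw [h3 l hlm, h3 r hrm] at h2
  have h4 : (U.filter (fun v => ¬ SamePair c (v i) m)).card =
      num U (fun v => ¬ SamePair c (v i) m) := by
    unfold num
    congr!
  omega

theorem Crit.cross (h : Crit c J V W) {i : ι} (hi : i ∈ J) {l : S} {a : ι → S}
    (ha : a ∈ V ∨ a ∈ W) (hal : SamePair c (a i) l) : Cross c J i W V l := by
  by_contra hY
  have hX : Cross c J i V W l := by
    rcases ha with ha | ha
    · exact (h.cross_or_cross hi ha hal).resolve_right hY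
    · exact (h.symm.cross_or_cross hi ha hal).resolve_left hY
  have h12 := h.twelve_le_num hi hX hY
  obtain ⟨v, hv, w, hw, hvl, hwl, hvw⟩ := hX
  have hwv : Cross c J i W V (w i) := ⟨w, hw, v, hv, samePair_self _,
    fun h' => hwl (samePair_trans (samePair_symm h') hvl), fun h' => hvw h'.symm⟩
  have hVc := h.card_le
  have hWc := h.symm.card_le
  have hlw : ¬ SamePair c l (w i) := fun h' => hwl (samePair_symm h')
  by_cases hwX : Cross c J i V W (w i)
  · obtain ⟨v2, hv2, w2, hw2, hvw2, hww2, hvw2'⟩ := hwX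
    by_cases hw2l : SamePair c (w2 i) l
    · exact hY ⟨w2, hw2, v2, hv2, hw2l, fun h' => hwl (samePair_trans (samePair_symm hvw2) h'),
        fun h' => hvw2' h'.symm⟩
    · have h1 := h.eight_le_total' hi (Or.inr hw) (samePair_self _)
      have h2 := h.eight_le_total' hi (Or.inr hw2) (samePair_self _)
      unfold total at h1 h2
      have h3 := num_add_num_add_num_le V i (l := l) (r := w i) (m := w2 i) hlw
        (fun h' => hw2l (samePair_symm h')) (fun h' => hww2 (samePair_symm h'))
      have h4 := num_add_num_add_num_le W i (l := l) (r := w i) (m := w2 i) hlw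
        (fun h' => hw2l (samePair_symm h')) (fun h' => hww2 (samePair_symm h'))
      omega
  · have h1 := h.symm.twelve_le_num hi hwv hwX
    have h2 := num_add_num_le V i hlw
    have h3 := num_add_num_le W i hlw
    omega

theorem Crit.cross' (h : Crit c J V W) {i : ι} (hi : i ∈ J) {l : S} {a : ι → S}
    (ha : a ∈ V ∨ a ∈ W) (hal : SamePair c (a i) l) : Cross c J i V W l :=
  h.symm.cross hi ha.symm hal

/-- At most two pairs of letters occur at each position. -/
theorem Crit.samePair_or (h : Crit c J V W) {i : ι} (hi : i ∈ J) {a b u : ι → S}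
    (ha : a ∈ V ∨ a ∈ W) (hb : b ∈ V ∨ b ∈ W) (hu : u ∈ V ∨ u ∈ W)
    (hab : ¬ SamePair c (b i) (a i)) : SamePair c (u i) (a i) ∨ SamePair c (u i) (b i) := by
  by_contra! h'
  have h1 := h.eight_le_total' hi ha (samePair_self _)
  have h2 := h.eight_le_total' hi hb (samePair_self _)
  have h3 := h.eight_le_total' hi hu (samePair_self _)
  have hVc := h.card_le
  have hWc := h.symm.card_le
  unfold total at h1 h2 h3
  have h4 := num_add_num_add_num_le V i (l := b i) (r := a i) (m := u i) hab
    (fun h2 => h'.2 (samePair_symm h2)) (fun h2 => h'.1 (samePair_symm h2))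
  have h5 := num_add_num_add_num_le W i (l := b i) (r := a i) (m := u i) hab
    (fun h2 => h'.2 (samePair_symm h2)) (fun h2 => h'.1 (samePair_symm h2))
  omega

theorem Crit.four_le_num_samePair (h : Crit c J V W) {i : ι} (hi : i ∈ J) {l : S} {a : ι → S}
    (ha : a ∈ V ∨ a ∈ W) (hal : SamePair c (a i) l) :
    4 ≤ num V (fun v => SamePair c (v i) l) ∧ 4 ≤ num V (fun v => ¬ SamePair c (v i) l) := by
  refine ⟨h.four_le_num hi (h.cross' hi ha hal), ?_⟩
  obtain ⟨w, -, v, hv, hwl, hvl, -⟩ := h.cross hi ha hal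
  refine (h.four_le_num hi (h.cross' hi (Or.inl hv) (samePair_self _))).trans
    (num_mono fun u _ hu hul => hvl (samePair_trans (samePair_symm hu) hul))

end Critical

section Small

variable {ι : Type} {c : S → S}

/-- The words of `V` with letter `l` at `i` are `p` and `q`, which are dichotomous at `j`, and
there are at most three words with the complementary letter at `i`. -/
structure Small (c : S → S) (J : Finset ι) (V W : Finset (ι → S)) (i j : ι) (l : S)
    (p q : ι → S) : Prop where
  crit : Crit c J V W
  hi : i ∈ J
  hj : j ∈ J.erase i
  hp : p ∈ sl V i l
  hq : q ∈ sl V i l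
  eq_or : ∀ v ∈ sl V i l, v = p ∨ v = q
  compl : q j = c (p j)
  card_le : (sl V i (c l)).card ≤ 3

variable [Complementation c] {J : Finset ι} {V W : Finset (ι → S)} {i j : ι} {l : S} {p q : ι → S}

theorem Small.swap (h : Small c J V W i j l p q) : Small c J V W i j l q p where
  crit := h.crit
  hi := h.hi
  hj := h.hj
  hp := h.hq
  hq := h.hp
  eq_or := fun v hv => (h.eq_or v hv).symm
  compl := by rw [h.compl, Complementation.invol (c := c)]
  card_le := h.card_le

omit [Complementation c] in
theorem Small.p_mem (h : Small c J V W i j l p q) : p ∈ V := (mem_sl.1 h.hp).1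

omit [Complementation c] in
theorem Small.p_i (h : Small c J V W i j l p q) : p i = l := (mem_sl.1 h.hp).2

omit [Complementation c] in
theorem Small.j_mem (h : Small c J V W i j l p q) : j ∈ J := Finset.mem_of_mem_erase h.hj

theorem Small.not_dichoOn (h : Small c J V W i j l p q) {v w : ι → S} (hv : v ∈ V)
    (hvl : SamePair c (v i) l) (hw : w ∈ W) (hwl : ¬ SamePair c (w i) l)
    (hvw : ¬ DichoOn c (J.erase i) v w) :
    ¬ DichoOn c (J.erase i) p w ∧ ¬ DichoOn c (J.erase i) q w ∧
      2 ≤ (meeting c (J.erase i) (sl V i (c l)) w).card := by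
  obtain ⟨-, -, h3⟩ := h.crit.four_le_meeting h.hi hv hvl hw hwl hvw
  have h4 := Finset.card_le_card (meeting_subset (c := c) (J.erase i) (sl V i (c l)) w)
  have hsub : sl V i l ⊆ {p, q} := fun v hv => by
    simpa using h.eq_or v hv
  have h5 := (Finset.card_le_card hsub).trans Finset.card_le_two
  have h6 := Finset.card_le_card (meeting_subset (c := c) (J.erase i) (sl V i l) w)
  have h7 := h.card_le
  have h8 : meeting c (J.erase i) (sl V i l) w = sl V i l :=
    Finset.eq_of_subset_of_card_le (meeting_subset _ _ _) (by omega)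
  refine ⟨(mem_meeting.1 (h8 ▸ h.hp)).2, (mem_meeting.1 (h8 ▸ h.hq)).2, by omega⟩

theorem Small.not_samePair (h : Small c J V W i j l p q) {v w : ι → S} (hv : v ∈ V)
    (hvl : SamePair c (v i) l) (hw : w ∈ W) (hwl : ¬ SamePair c (w i) l)
    (hvw : ¬ DichoOn c (J.erase i) v w) : ¬ SamePair c (w j) (p j) := by
  obtain ⟨h1, h2, -⟩ := h.not_dichoOn hv hvl hw hwl hvw
  rintro (h' | h')
  · exact h2 ⟨j, h.hj, by rw [h', h.compl, Complementation.invol (c := c)]⟩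
  · exact h1 ⟨j, h.hj, h'⟩

theorem Small.cov_iff (h : Small c J V W i j l p q) {v w : ι → S} (hv : v ∈ V)
    (hvl : SamePair c (v i) l) (hw : w ∈ W) (hwl : ¬ SamePair c (w i) l)
    (hvw : ¬ DichoOn c (J.erase i) v w) {x : ι → Set S} (hx : Transversal c x)
    (hxw : MemOn ((J.erase i).erase j) x w) :
    MemOn ((J.erase i).erase j) x p ↔
      ∃ r ∈ sl V i (c l), (r j = p j ∨ r j = w j) ∧ MemOn ((J.erase i).erase j) x r := by
  have hwb := h.not_samePair hv hvl hw hwl hvw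
  obtain ⟨B, hB, hB1, hB2⟩ := exists_eSet_pair (c := c) (s := p j) (t := w j)
    (fun h' => hwb (Or.inr h'))
  have hy := transversal_update hx j hB
  have := h.crit.eqvOn h.hi hw hwl _ hy ((memOn_update_iff h.hj).2 ⟨hB2, hxw⟩)
  constructor
  · intro hxp
    obtain ⟨r, hr, hyr⟩ := this.1 ⟨p, h.hp, (memOn_update_iff h.hj).2 ⟨hB1, hxp⟩⟩
    rw [memOn_update_iff h.hj] at hyr
    refine ⟨r, hr, ?_, hyr.2⟩
    have hrV := (mem_sl.1 hr).1
    rcases h.crit.samePair_or h.j_mem (Or.inl h.p_mem) (Or.inr hw) (Or.inl hrV) hwb with h' | h'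
    · rcases h' with h' | h'
      · exact Or.inl h'
      · exact absurd hB1 ((compl_mem_iff hB _).1 (h' ▸ hyr.1))
    · rcases h' with h' | h'
      · exact Or.inr h'
      · exact absurd hB2 ((compl_mem_iff hB _).1 (h' ▸ hyr.1))
  · rintro ⟨r, hr, hrj, hxr⟩
    obtain ⟨v, hv, hyv⟩ := this.2 ⟨r, hr, (memOn_update_iff h.hj).2
      ⟨by rcases hrj with h' | h' <;> rw [h'] <;> assumption, hxr⟩⟩
    rw [memOn_update_iff h.hj] at hyv
    rcases h.eq_or v hv with rfl | rfl
    · exact hyv.2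
    · exact absurd hB1 ((compl_mem_iff hB _).1 (h.compl ▸ hyv.1))

omit [Complementation c] in
theorem Small.right_not_agreeOn (h : Small c J V W i j l p q) {r : ι → S}
    (hr : r ∈ sl V i (c l)) (hrj : r j = p j) : ¬ AgreeOn ((J.erase i).erase j) r p := by
  intro hag
  refine h.crit.left.sl_not_agreeOn h.hi l p h.hp r hr fun k hk => ?_
  by_cases hkj : k = j
  · rw [hkj, hrj]
  · exact (hag k (Finset.mem_erase.2 ⟨hkj, hk⟩)).symm

/-- If no word of the complementary side has the letter of `p` at `j`, exactly one of them has
the letter of `w` at `j`, and it agrees with `p`. -/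
theorem Small.exists_agreeOn (h : Small c J V W i j l p q) {v w : ι → S} (hv : v ∈ V)
    (hvl : SamePair c (v i) l) (hw : w ∈ W) (hwl : ¬ SamePair c (w i) l)
    (hvw : ¬ DichoOn c (J.erase i) v w)
    (hno : ∀ r ∈ sl V i (c l), ¬ DichoOn c ((J.erase i).erase j) r w → r j ≠ p j) :
    ∃ d ∈ sl V i (c l), d j = w j ∧ AgreeOn ((J.erase i).erase j) d p ∧
      ∀ e ∈ sl V i (c l), ¬ DichoOn c ((J.erase i).erase j) e w → e j = w j → e = d := by
  obtain ⟨h1, -, -⟩ := h.not_dichoOn hv hvl hw hwl hvw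
  obtain ⟨d, hd, hdp, hde⟩ := exists_agreeOn_of_card_le (K := (J.erase i).erase j)
    (D := sl (sl V i (c l)) j (w j)) (u := p) (w := w) ((h.crit.left.sl i (c l)).sl j (w j))
    (fun h' => h1 (h'.mono (Finset.erase_subset _ _)))
    (fun x hx hxw => by
      rw [h.cov_iff hv hvl hw hwl hvw hx hxw]
      constructor
      · rintro ⟨r, hr, hxr⟩
        rw [mem_sl] at hr
        exact ⟨r, hr.1, Or.inr hr.2, hxr⟩
      · rintro ⟨r, hr, hrj, hxr⟩
        refine ⟨r, mem_sl.2 ⟨hr, hrj.resolve_left ?_⟩, hxr⟩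
        exact hno r hr (not_dichoOn_of_memOn hx hxr hxw))
    (by
      have h1 := Finset.card_le_card (meeting_subset (c := c) ((J.erase i).erase j)
        (sl (sl V i (c l)) j (w j)) w)
      have h2 := Finset.card_le_card (sl_subset (sl V i (c l)) j (w j))
      have h3 := h.card_le
      omega)
  rw [mem_sl] at hd
  exact ⟨d, hd.1, hd.2, hdp, fun e he hew hej => hde e (mem_sl.2 ⟨he, hej⟩) hew⟩

theorem Small.exists_crossing (h : Small c J V W i j l p q) {v w : ι → S} (hv : v ∈ V)
    (hvl : SamePair c (v i) l) (hw : w ∈ W) (hwl : ¬ SamePair c (w i) l)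
    (hvw : ¬ DichoOn c (J.erase i) v w) :
    ∃ r ∈ sl V i (c l), r j = w j ∧ ¬ DichoOn c ((J.erase i).erase j) r w ∧
      (∃ s ∈ sl V i (c l), SamePair c (s j) (p j) ∧ ¬ DichoOn c ((J.erase i).erase j) s w) ∧
      ((∀ s ∈ sl V i (c l), s j ≠ p j) → AgreeOn ((J.erase i).erase j) r p) ∧
      ((∀ s ∈ sl V i (c l), s j ≠ q j) → AgreeOn ((J.erase i).erase j) r q) := by
  have hwb := h.not_samePair hv hvl hw hwl hvw
  obtain ⟨h1, h2, h3⟩ := h.not_dichoOn hv hvl hw hwl hvw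
  have hpm : ¬ DichoOn c ((J.erase i).erase j) p w := fun h' =>
    h1 (h'.mono (Finset.erase_subset _ _))
  have hex : ∃ r ∈ sl V i (c l), r j = w j ∧ ¬ DichoOn c ((J.erase i).erase j) r w := by
    by_contra! hno
    have h5 := local_bound (K := (J.erase i).erase j)
      (D := sl (sl V i (c l)) j (p j)) (u := p) (w := w) ((h.crit.left.sl i (c l)).sl j (p j)) hpm
      (fun x hx hxw => by
        rw [h.cov_iff hv hvl hw hwl hvw hx hxw]
        constructor
        · rintro ⟨r, hr, hxr⟩
          rw [mem_sl] at hr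
          exact ⟨r, hr.1, Or.inl hr.2, hxr⟩
        · rintro ⟨r, hr, hrj, hxr⟩
          refine ⟨r, mem_sl.2 ⟨hr, hrj.resolve_right fun h' => ?_⟩, hxr⟩
          exact not_dichoOn_of_memOn hx hxr hxw (hno r hr h'))
      (fun d hd => by
        rw [mem_sl] at hd
        exact h.right_not_agreeOn hd.1 hd.2)
    have h6 := Finset.card_le_card (meeting_subset (c := c) ((J.erase i).erase j)
      (sl (sl V i (c l)) j (p j)) w)
    have h7 := Finset.card_le_card (sl_subset (sl V i (c l)) j (p j))
    have h8 := h.card_le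
    omega
  obtain ⟨r, hr, hrj, hrw⟩ := hex
  have huniq : ∀ e ∈ sl V i (c l), ¬ DichoOn c ((J.erase i).erase j) e w → e j = w j → e = r := by
    intro e he hew hej
    by_cases ha : ∀ r ∈ sl V i (c l), ¬ DichoOn c ((J.erase i).erase j) r w → r j ≠ p j
    · obtain ⟨d, -, -, -, hd⟩ := h.exists_agreeOn hv hvl hw hwl hvw ha
      rw [hd e he hew hej, hd r hr hrw hrj]
    by_cases hb : ∀ r ∈ sl V i (c l), ¬ DichoOn c ((J.erase i).erase j) r w → r j ≠ q j
    · obtain ⟨d, -, -, -, hd⟩ := h.swap.exists_agreeOn hv hvl hw hwl hvw hb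
      rw [hd e he hew hej, hd r hr hrw hrj]
    push Not at ha hb
    obtain ⟨a, ha, -, haj⟩ := ha
    obtain ⟨b, hb, -, hbj⟩ := hb
    by_contra hne
    have hsub : ({a, b, e, r} : Finset (ι → S)) ⊆ sl V i (c l) := by
      intro z hz
      simp only [Finset.mem_insert, Finset.mem_singleton] at hz
      rcases hz with rfl | rfl | rfl | rfl <;> assumption
    have hn1 : a ≠ b := by
      rintro rfl
      rw [haj, h.compl] at hbj
      exact Complementation.ne (c := c) _ hbj.symm
    have hn2 : ∀ z, z j = w j → a ≠ z ∧ b ≠ z := by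
      intro z hz
      refine ⟨?_, ?_⟩
      · rintro rfl
        exact hwb (Or.inl (by rw [← hz, haj]))
      · rintro rfl
        exact hwb (Or.inr (by rw [← hz, hbj, h.compl]))
    have hcard : ({a, b, e, r} : Finset (ι → S)).card = 4 := by
      rw [Finset.card_insert_of_notMem, Finset.card_insert_of_notMem,
        Finset.card_pair hne]
      · simp [(hn2 e hej).2, (hn2 r hrj).2]
      · simp [hn1, (hn2 e hej).1, (hn2 r hrj).1]
    have := Finset.card_le_card hsub
    have := h.card_le
    omega
  refine ⟨r, hr, hrj, hrw, ?_, ?_, ?_⟩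
  · obtain ⟨s, hs, hsr⟩ := Finset.exists_mem_ne
      (s := meeting c (J.erase i) (sl V i (c l)) w) (by omega) r
    rw [mem_meeting] at hs
    have hsw : ¬ DichoOn c ((J.erase i).erase j) s w := fun h' =>
      hs.2 (h'.mono (Finset.erase_subset _ _))
    refine ⟨s, hs.1, ?_, hsw⟩
    refine (h.crit.samePair_or h.j_mem (Or.inl h.p_mem) (Or.inr hw) (Or.inl (mem_sl.1 hs.1).1)
      hwb).resolve_right ?_
    rintro (h' | h')
    · exact hsr (huniq s hs.1 hsw h')
    · exact hs.2 (DichoOn.symm ⟨j, h.hj, h'⟩)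
  · intro hno
    obtain ⟨d, -, -, hd, hd'⟩ := h.exists_agreeOn hv hvl hw hwl hvw (fun s hs _ => hno s hs)
    rwa [hd' r hr hrw hrj]
  · intro hno
    obtain ⟨d, -, -, hd, hd'⟩ := h.swap.exists_agreeOn hv hvl hw hwl hvw (fun s hs _ => hno s hs)
    rwa [hd' r hr hrw hrj]

/-- There is a word of `W` with letter `l` at `i` whose letter at `j` is not in the pair of
`p j`, and which shares a point with `p` and `q` away from `i` and `j`. -/
theorem Small.exists_left (h : Small c J V W i j l p q) :
    ∃ t ∈ W, t i = l ∧ ¬ SamePair c (t j) (p j) ∧ ∃ x, Transversal c x ∧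
      MemOn ((J.erase i).erase j) x t ∧ MemOn ((J.erase i).erase j) x p ∧
      MemOn ((J.erase i).erase j) x q := by
  obtain ⟨v, hv, e, he, hvl, hel, hve⟩ := h.crit.cross' h.hi (Or.inl h.p_mem) (Or.inl h.p_i)
  have heb := h.not_samePair hv hvl he hel hve
  obtain ⟨r, hr, hrj, hre, ⟨s, hs, hsj, -⟩, h1, h2⟩ := h.exists_crossing hv hvl he hel hve
  obtain ⟨x, hx, hxr, hxe⟩ := exists_common_point hre
  have hxp : MemOn ((J.erase i).erase j) x p :=
    (h.cov_iff hv hvl he hel hve hx hxe).2 ⟨r, hr, Or.inr hrj, hxr⟩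
  have hxq : MemOn ((J.erase i).erase j) x q :=
    (h.swap.cov_iff hv hvl he hel hve hx hxe).2 ⟨r, hr, Or.inr hrj, hxr⟩
  have hrV := mem_sl.1 hr
  have hrl : SamePair c (r i) l := Or.inr hrV.2
  obtain ⟨B, hB, hBe, -⟩ := exists_eSet_pair (c := c) (s := e j) (t := e j)
    (Complementation.ne (c := c) _).symm
  obtain ⟨f, hf, hyf⟩ := h.crit.toSys.symm.exists_compl h.hi (l := e i) hrV.1
    (fun h' => hel (Or.inr (by rw [← h', hrV.2]))) (transversal_update hx j hB)
    ((memOn_update_iff h.hj).2 ⟨hrj ▸ hBe, hxr⟩)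
    ⟨e, mem_sl.2 ⟨he, rfl⟩, (memOn_update_iff h.hj).2 ⟨hBe, hxe⟩⟩
  rw [mem_sl] at hf
  rw [memOn_update_iff h.hj] at hyf
  have hfl : ¬ SamePair c (f i) l := by
    rw [hf.2, compl_samePair]
    exact hel
  have hfb := h.not_samePair (v := r) hrV.1 hrl hf.1 hfl
    (not_dichoOn_of_memOn (transversal_update hx j hB) ((memOn_update_iff h.hj).2 ⟨hrj ▸ hBe, hxr⟩)
      ((memOn_update_iff h.hj).2 hyf))
  have hfj : f j = e j := by
    rcases (h.crit.samePair_or h.j_mem (Or.inl h.p_mem) (Or.inr he) (Or.inr hf.1)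
      heb).resolve_left hfb with h' | h'
    · exact h'
    · exact absurd hBe ((compl_mem_iff hB _).1 (h' ▸ hyf.1))
  obtain ⟨A, hA, hAl, -⟩ := exists_eSet_pair (c := c) (s := l) (t := l)
    (Complementation.ne (c := c) _).symm
  have hz := transversal_update (transversal_update hx j (compl_mem_eSet hB)) i hA
  have hmem : ∀ u, MemOn J (Function.update (Function.update x j Bᶜ) i A) u ↔
      u i ∈ A ∧ u j ∉ B ∧ MemOn ((J.erase i).erase j) x u := fun u => by
    rw [memOn_update_iff h.hi, memOn_update_iff h.hj]
    rfl
  obtain ⟨u, hu, hul, hzu⟩ : ∃ u ∈ V, SamePair c (u i) l ∧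
      MemOn J (Function.update (Function.update x j Bᶜ) i A) u := by
    by_cases hpB : p j ∈ B
    · refine ⟨q, h.swap.p_mem, Or.inl h.swap.p_i, (hmem q).2 ⟨h.swap.p_i ▸ hAl, ?_, hxq⟩⟩
      rw [h.compl, compl_mem_iff hB]
      exact fun h' => h' hpB
    · exact ⟨p, h.p_mem, Or.inl h.p_i, (hmem p).2 ⟨h.p_i ▸ hAl, hpB, hxp⟩⟩
  obtain ⟨t, ht, hzt⟩ := h.crit.toSys.symm.cov hz hu hzu
  have htm := (hmem t).1 hzt
  have htj : t j = c (e j) := by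
    have key : ∀ g ∈ W, g j = e j → MemOn ((J.erase i).erase j) x g →
        t i = c (g i) ∨ t j = c (e j) := by
      intro g hg hgj hxg
      obtain ⟨k, hk, hkg⟩ := h.crit.right.dich g hg t ht (by
        rintro rfl
        exact htm.2.1 (hgj ▸ hBe))
      by_cases hki : k = i
      · exact Or.inl (hki ▸ hkg)
      by_cases hkj : k = j
      · exact Or.inr (by rw [← hkj, hkg, hkj, hgj])
      · exact absurd ⟨k, Finset.mem_erase.2 ⟨hkj, Finset.mem_erase.2 ⟨hki, hk⟩⟩, hkg⟩
          (not_dichoOn_of_memOn hx hxg htm.2.2)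
    rcases key e he rfl hxe with h' | h'
    · rcases key f hf.1 hfj hyf.2 with h'' | h''
      · rw [h', hf.2, Complementation.invol (c := c)] at h''
        exact absurd h'' (Complementation.ne (c := c) _)
      · exact h''
    · exact h'
  have htb : ¬ SamePair c (t j) (p j) := by
    rw [htj, compl_samePair]
    exact heb
  refine ⟨t, ht, ?_, htb, x, hx, htm.2.2, hxp, hxq⟩
  by_contra htl
  have htl' : ¬ SamePair c (t i) l := by
    rintro (h' | h')
    · exact htl h'
    · exact (compl_mem_iff hA l).1 (h' ▸ htm.1) hAl
  obtain ⟨r', hr', hr'j, -, ⟨s', hs', hs'j, -⟩, h1', h2'⟩ := h.exists_crossing hu hul ht htl'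
    (fun h' => not_dichoOn_of_memOn hz hzu hzt (h'.mono (Finset.erase_subset _ _)))
  have hrr' : r' j = c (r j) := by rw [hr'j, htj, hrj]
  have hb : ∀ z ∈ sl V i (c l), z = s ∨ z = r ∨ z = r' := by
    have hsub : ({s, r, r'} : Finset (ι → S)) ⊆ sl V i (c l) := by
      intro z hz
      simp only [Finset.mem_insert, Finset.mem_singleton] at hz
      rcases hz with rfl | rfl | rfl <;> assumption
    have hcard : ({s, r, r'} : Finset (ι → S)).card = 3 := by
      rw [Finset.card_insert_of_notMem, Finset.card_pair]
      · rintro rfl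
        exact Complementation.ne (c := c) _ hrr'.symm
      · simp only [Finset.mem_insert, Finset.mem_singleton]
        rintro (rfl | rfl)
        · exact heb (hrj ▸ hsj)
        · exact htb (hr'j ▸ hsj)
    have := Finset.eq_of_subset_of_card_le hsub (by rw [hcard]; exact h.card_le)
    intro z hz
    rw [← this] at hz
    simpa using hz
  have key : ∀ y, SamePair c y (p j) → s j ≠ y → ∀ z ∈ sl V i (c l), z j ≠ y := by
    intro y hy hsy z hz hzy
    rcases hb z hz with rfl | rfl | rfl
    · exact hsy hzy
    · exact heb (by rw [← hrj, hzy]; exact hy)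
    · exact htb (by rw [← hr'j, hzy]; exact hy)
  have hfin : ∀ y : ι → S, AgreeOn ((J.erase i).erase j) r y →
      AgreeOn ((J.erase i).erase j) r' y → False := by
    intro y hy hy'
    refine (h.crit.left.sl i (c l)).not_agreeOn h.hj hr hr' hrr' fun k hk => ?_
    rw [hy k hk, hy' k hk]
  by_cases hsp : s j = p j
  · have hq' : s j ≠ q j := by
      rw [hsp, h.compl]
      exact (Complementation.ne (c := c) _).symm
    have := key (q j) (Or.inr h.compl) hq'
    exact hfin q (h2 this) (h2' this)
  · have := key (p j) (samePair_self _) hsp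
    exact hfin p (h1 this) (h1' this)

end Small

section Cells

variable {ι : Type} {c : S → S} [Complementation c] {J : Finset ι} {V W : Finset (ι → S)}
  {i j : ι} {l : S} {p q : ι → S}

theorem Small.samePair_swap (h : Small c J V W i j l p q) {s : S} :
    SamePair c s (q j) ↔ SamePair c s (p j) := by
  rw [h.compl, samePair_compl]

theorem Small.cov_of_left (h : Small c J V W i j l p q) {t e : ι → S} (ht : t ∈ W) (hti : t i = l)
    (htj : ¬ SamePair c (t j) (p j)) (he : e ∈ V ∨ e ∈ W) (hel : ¬ SamePair c (e i) l) {s : S}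
    (hs : SamePair c s (e i)) {x : ι → Set S} (hx : Transversal c x)
    (hxt : MemOn ((J.erase i).erase j) x t)
    (hxp : MemOn ((J.erase i).erase j) x p ∨
      ∃ v ∈ V, v j = p j ∧ v i = s ∧ MemOn ((J.erase i).erase j) x v) :
    MemOn ((J.erase i).erase j) x q ∨
      ∃ v ∈ V, v j = q j ∧ v i = s ∧ MemOn ((J.erase i).erase j) x v := by
  have hsl : ¬ SamePair c s l := fun h' => hel (samePair_trans (samePair_symm hs) h')
  have hij : i ∈ J.erase j :=
    Finset.mem_erase.2 ⟨fun h' => (Finset.mem_erase.1 h.hj).1 h'.symm, h.hi⟩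
  obtain ⟨B, hB, hBl, hBs⟩ := exists_eSet_pair (c := c) (s := l) (t := s)
    (fun h' => hsl (Or.inr h'))
  have hmem : ∀ u, MemOn (J.erase j) (Function.update x i B) u ↔
      u i ∈ B ∧ MemOn ((J.erase i).erase j) x u := fun u => by
    rw [memOn_update_iff hij, Finset.erase_right_comm]
  obtain ⟨v, hv, hyv⟩ := (h.crit.eqvOn h.j_mem ht htj _ (transversal_update hx i hB)
    ((hmem t).2 ⟨hti ▸ hBl, hxt⟩)).1 (by
      rcases hxp with hxp | ⟨v, hv, hvj, hvi, hxv⟩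
      · exact ⟨p, mem_sl.2 ⟨h.p_mem, rfl⟩, (hmem p).2 ⟨h.p_i ▸ hBl, hxp⟩⟩
      · exact ⟨v, mem_sl.2 ⟨hv, hvj⟩, (hmem v).2 ⟨hvi ▸ hBs, hxv⟩⟩)
  rw [mem_sl] at hv
  rw [hmem] at hyv
  by_cases hvl : SamePair c (v i) l
  · rcases hvl with hvl | hvl
    · rcases h.eq_or v (mem_sl.2 ⟨hv.1, hvl⟩) with rfl | rfl
      · exact absurd hv.2.symm (Complementation.ne (c := c) _)
      · exact Or.inl hyv.2
    · exact absurd hBl ((compl_mem_iff hB l).1 (hvl ▸ hyv.1))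
  · have hvs : SamePair c (v i) (e i) :=
      (h.crit.samePair_or h.hi (Or.inl h.p_mem) he (Or.inl hv.1) (by rwa [h.p_i])).resolve_left
        (by rwa [h.p_i])
    rcases samePair_trans hvs (samePair_symm hs) with hvs | hvs
    · exact Or.inr ⟨v, hv.1, by rw [hv.2, h.compl], hvs, hyv.2⟩
    · exact absurd hBs ((compl_mem_iff hB s).1 (hvs ▸ hyv.1))

theorem Small.cov_iff_left (h : Small c J V W i j l p q) {t e : ι → S} (ht : t ∈ W)
    (hti : t i = l) (htj : ¬ SamePair c (t j) (p j)) (he : e ∈ V ∨ e ∈ W)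
    (hel : ¬ SamePair c (e i) l) {s : S} (hs : SamePair c s (e i)) {x : ι → Set S}
    (hx : Transversal c x) (hxt : MemOn ((J.erase i).erase j) x t) :
    (MemOn ((J.erase i).erase j) x p ∨
      ∃ v ∈ V, v j = p j ∧ v i = s ∧ MemOn ((J.erase i).erase j) x v) ↔
    (MemOn ((J.erase i).erase j) x q ∨
      ∃ v ∈ V, v j = q j ∧ v i = s ∧ MemOn ((J.erase i).erase j) x v) :=
  ⟨h.cov_of_left ht hti htj he hel hs hx hxt,
    h.swap.cov_of_left ht hti (by rwa [h.samePair_swap]) he hel hs hx hxt⟩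

theorem Small.three_le_right_aux (h : Small c J V W i j l p q) {t e u u' : ι → S} (ht : t ∈ W)
    (hti : t i = l) (htj : ¬ SamePair c (t j) (p j)) (he : e ∈ V ∨ e ∈ W)
    (hel : ¬ SamePair c (e i) l) (hu : u ∈ V) (hui : u i = e i) (huj : u j = p j)
    (hut : ¬ DichoOn c ((J.erase i).erase j) u t) (hu' : u' ∈ V) (hui' : u' i = c (e i))
    (huj' : SamePair c (u' j) (p j)) (hut' : ¬ DichoOn c ((J.erase i).erase j) u' t)
    (hall : ∀ v ∈ V, ¬ SamePair c (v i) l → SamePair c (v j) (p j) → v = u ∨ v = u') : False := by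
  have hel' : ¬ SamePair c (c (e i)) l := by rwa [compl_samePair]
  have hne := Complementation.ne (c := c)
  have hA : ∀ v ∈ V, SamePair c (v j) (p j) → v i = e i → v = u := fun v hv hvj hvi =>
    (hall v hv (by rwa [hvi]) hvj).resolve_right (by
      rintro rfl
      exact hne _ (hui'.symm.trans hvi))
  have hA' : ∀ v ∈ V, SamePair c (v j) (p j) → v i = c (e i) → v = u' := fun v hv hvj hvi =>
    (hall v hv (by rwa [hvi]) hvj).resolve_left (by
      rintro rfl
      exact hne _ (hvi.symm.trans hui))
  have hB : ∀ x, Transversal c x → MemOn ((J.erase i).erase j) x t →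
      (MemOn ((J.erase i).erase j) x p ∨ MemOn ((J.erase i).erase j) x u ↔
        MemOn ((J.erase i).erase j) x q) := by
    intro x hx hxt
    constructor
    · intro hp
      refine (h.cov_of_left ht hti htj he hel (samePair_self _) hx hxt
        (hp.imp_right fun hp => ⟨u, hu, huj, hui, hp⟩)).resolve_right ?_
      rintro ⟨v, hv, hvj, hvi, -⟩
      have := hA v hv (Or.inr (by rw [hvj, h.compl])) hvi
      rw [this, huj, h.compl] at hvj
      exact hne _ hvj.symm
    · intro hq
      refine ((h.cov_iff_left ht hti htj he hel (samePair_self _) hx hxt).2 (Or.inl hq)).imp_right ?_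
      rintro ⟨v, hv, hvj, hvi, hxv⟩
      rwa [← hA v hv (Or.inl hvj) hvi]
  have hdis : ∀ v ∈ V, v j = p j → ¬ SamePair c (v i) l → ∀ x, Transversal c x →
      MemOn ((J.erase i).erase j) x v → ¬ MemOn ((J.erase i).erase j) x p := by
    intro v hv hvj hvi x hx hxv hxp
    have hvp : v ≠ p := by
      rintro rfl
      exact hvi (Or.inl h.p_i)
    obtain ⟨k, hk, hkv⟩ := h.crit.left.dich v hv p h.p_mem hvp
    by_cases hki : k = i
    · rw [hki, h.p_i] at hkv
      exact hvi (Or.inr (by rw [hkv, Complementation.invol (c := c)]))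
    by_cases hkj : k = j
    · rw [hkj, hvj] at hkv
      exact hne _ hkv.symm
    exact not_dichoOn_of_memOn hx hxv hxp
      ⟨k, Finset.mem_erase.2 ⟨hkj, Finset.mem_erase.2 ⟨hki, hk⟩⟩, hkv⟩
  rcases huj' with huj' | huj'
  · have hB' : ∀ x, Transversal c x → MemOn ((J.erase i).erase j) x t →
        (MemOn ((J.erase i).erase j) x p ∨ MemOn ((J.erase i).erase j) x u' ↔
          MemOn ((J.erase i).erase j) x q) := by
      intro x hx hxt
      constructor
      · intro hp
        refine (h.cov_of_left ht hti htj he hel (Or.inr rfl) hx hxt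
          (hp.imp_right fun hp => ⟨u', hu', huj', hui', hp⟩)).resolve_right ?_
        rintro ⟨v, hv, hvj, hvi, -⟩
        have := hA' v hv (Or.inr (by rw [hvj, h.compl])) hvi
        rw [this, huj', h.compl] at hvj
        exact hne _ hvj.symm
      · intro hq
        refine ((h.cov_iff_left ht hti htj he hel (Or.inr rfl) hx hxt).2 (Or.inl hq)).imp_right ?_
        rintro ⟨v, hv, hvj, hvi, hxv⟩
        rwa [← hA' v hv (Or.inl hvj) hvi]
    have hag := agreeOn_of_box_eq hut hut' fun x hx hxt => by
      constructor
      · intro hxu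
        exact ((hB' x hx hxt).2 ((hB x hx hxt).1 (Or.inr hxu))).resolve_left
          (hdis u hu huj (by rwa [hui]) x hx hxu)
      · intro hxu
        exact ((hB x hx hxt).2 ((hB' x hx hxt).1 (Or.inr hxu))).resolve_left
          (hdis u' hu' huj' (by rwa [hui']) x hx hxu)
    refine h.crit.left.not_agreeOn h.hi hu hu' (by rw [hui', hui]) fun k hk => ?_
    by_cases hkj : k = j
    · rw [hkj, huj, huj']
    · exact hag k (Finset.mem_erase.2 ⟨hkj, hk⟩)
  · obtain ⟨x, hx, hxu, hxt⟩ := exists_common_point hut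
    have hxq := (hB x hx hxt).1 (Or.inr hxu)
    refine hdis u hu huj (by rwa [hui]) x hx hxu ?_
    refine ((h.cov_iff_left ht hti htj he hel (Or.inr rfl) hx hxt).2 (Or.inl hxq)).resolve_right ?_
    rintro ⟨v, hv, hvj, hvi, -⟩
    have := hA' v hv (Or.inl hvj) hvi
    rw [this, huj'] at hvj
    exact hne _ hvj

omit [Complementation c] in
theorem three_le_num {V : Finset (ι → S)} {f : (ι → S) → Prop} {u v w : ι → S} (hu : u ∈ V)
    (hv : v ∈ V) (hw : w ∈ V) (hfu : f u) (hfv : f v) (hfw : f w) (huv : u ≠ v) (huw : u ≠ w)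
    (hvw : v ≠ w) : 3 ≤ num V f :=
  Finset.two_lt_card.2 ⟨u, Finset.mem_filter.2 ⟨hu, hfu⟩, v, Finset.mem_filter.2 ⟨hv, hfv⟩, w,
    Finset.mem_filter.2 ⟨hw, hfw⟩, huv, huw, hvw⟩

theorem Small.three_le_right (h : Small c J V W i j l p q) :
    3 ≤ num V (fun v => ¬ SamePair c (v i) l ∧ SamePair c (v j) (p j)) := by
  obtain ⟨t, ht, hti, htj, x, hx, hxt, hxp, hxq⟩ := h.exists_left
  obtain ⟨-, -, e, he, -, hel, -⟩ := h.crit.cross' h.hi (Or.inl h.p_mem) (Or.inl h.p_i)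
  have hne := Complementation.ne (c := c)
  have hex : ∀ s, SamePair c s (e i) → ∃ v ∈ V, SamePair c (v j) (p j) ∧ v i = s ∧
      ¬ DichoOn c ((J.erase i).erase j) v t := by
    intro s hs
    by_contra! hno
    refine (h.crit.left.sl i l).not_agreeOn h.hj h.hp h.hq h.compl
      (agreeOn_of_box_eq (not_dichoOn_of_memOn hx hxp hxt) (not_dichoOn_of_memOn hx hxq hxt)
        fun y hy hyt => ?_)
    have := h.cov_iff_left ht hti htj (Or.inr he) hel hs hy hyt
    constructor
    · intro hyp
      refine (this.1 (Or.inl hyp)).resolve_right ?_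
      rintro ⟨v, hv, hvj, hvi, hyv⟩
      exact not_dichoOn_of_memOn hy hyv hyt (hno v hv (Or.inr (by rw [hvj, h.compl])) hvi)
    · intro hyq
      refine (this.2 (Or.inl hyq)).resolve_right ?_
      rintro ⟨v, hv, hvj, hvi, hyv⟩
      exact not_dichoOn_of_memOn hy hyv hyt (hno v hv (Or.inl hvj) hvi)
  obtain ⟨u, hu, huj, hui, hut⟩ := hex (e i) (samePair_self _)
  obtain ⟨u', hu', huj', hui', hut'⟩ := hex (c (e i)) (Or.inr rfl)
  have hel' : ¬ SamePair c (c (e i)) l := by rwa [compl_samePair]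
  by_contra hlt
  have hall : ∀ v ∈ V, ¬ SamePair c (v i) l → SamePair c (v j) (p j) → v = u ∨ v = u' := by
    intro v hv hvi hvj
    by_contra! hvu
    refine hlt (three_le_num hv hu hu' ⟨hvi, hvj⟩ ⟨by rwa [hui], huj⟩ ⟨by rwa [hui'], huj'⟩
      hvu.1 hvu.2 ?_)
    rintro rfl
    exact hne _ (hui'.symm.trans hui)
  rcases huj with huj | huj
  · exact h.three_le_right_aux ht hti htj (Or.inr he) hel hu hui huj hut hu' hui' huj' hut' hall
  · exact h.swap.three_le_right_aux ht hti (by rwa [h.samePair_swap]) (Or.inr he) hel hu hui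
      (by rw [huj, h.compl]) hut hu' hui' (by rwa [h.samePair_swap]) hut' (fun v hv hvi hvj =>
        hall v hv hvi (h.samePair_swap.1 hvj))

theorem Small.cells (h : Small c J V W i j l p q) :
    3 ≤ num V (fun v => SamePair c (v i) l ∧ SamePair c (v j) (p j)) ∧
    1 ≤ num V (fun v => SamePair c (v i) l ∧ ¬ SamePair c (v j) (p j)) ∧
    3 ≤ num V (fun v => ¬ SamePair c (v i) l ∧ SamePair c (v j) (p j)) ∧
    4 ≤ num W (fun v => ¬ SamePair c (v i) l ∧ ¬ SamePair c (v j) (p j)) ∧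
    1 ≤ num W (fun v => SamePair c (v i) l ∧ ¬ SamePair c (v j) (p j)) := by
  have hne := Complementation.ne (c := c)
  obtain ⟨t, ht, hti, htj, -⟩ := h.exists_left
  obtain ⟨v, hv, e, he, hvl, hel, hve⟩ := h.crit.cross' h.hi (Or.inl h.p_mem) (Or.inl h.p_i)
  have heb := h.not_samePair hv hvl he hel hve
  obtain ⟨r, hr, hrj, -, ⟨s, hs, hsj, -⟩, -, -⟩ := h.exists_crossing hv hvl he hel hve
  rw [mem_sl] at hr hs
  have hs' : ∀ a, a i = l → a ≠ s := by
    rintro a ha rfl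
    exact hne _ (hs.2.symm.trans ha)
  refine ⟨three_le_num h.p_mem h.swap.p_mem hs.1 ⟨Or.inl h.p_i, samePair_self _⟩
      ⟨Or.inl h.swap.p_i, Or.inr h.compl⟩ ⟨Or.inr hs.2, hsj⟩ ?_ (hs' _ h.p_i) (hs' _ h.swap.p_i),
    num_pos hr.1 ⟨Or.inr hr.2, by rwa [hrj]⟩, h.three_le_right, ?_, num_pos ht ⟨Or.inl hti, htj⟩⟩
  · rintro rfl
    exact hne _ h.compl.symm
  · have hpe := (h.not_dichoOn hv hvl he hel hve).1
    refine (h.crit.toSys.symm.four_le_num_and h.hi he (samePair_self _) h.p_mem (fun h' => hel ?_)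
      (fun h' => hpe h'.symm)).trans (num_mono fun u hu hu' => ?_)
    · rw [h.p_i] at h'
      exact samePair_symm h'
    · have hul : ¬ SamePair c (u i) l := fun h' =>
        hel (samePair_trans (samePair_symm hu'.2) h')
      exact ⟨hul, h.not_samePair h.p_mem (Or.inl h.p_i) hu hul fun h' => hu'.1 h'.symm⟩

/-- If a letter pair occurs at most five times in `V` at `i`, another position `j` has a letter
pair with unbalanced frequencies. -/
theorem Crit.exists_cells (h : Crit c J V W) (hi : i ∈ J) {a : ι → S}
    (ha : a ∈ V ∨ a ∈ W) (hal : SamePair c (a i) l)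
    (hle : num V (fun v => SamePair c (v i) l) ≤ 5) :
    ∃ j ∈ J.erase i, ∃ b ∈ V,
      3 ≤ num V (fun v => SamePair c (v i) l ∧ SamePair c (v j) (b j)) ∧
      1 ≤ num V (fun v => SamePair c (v i) l ∧ ¬ SamePair c (v j) (b j)) ∧
      3 ≤ num V (fun v => ¬ SamePair c (v i) l ∧ SamePair c (v j) (b j)) ∧
      4 ≤ num W (fun v => ¬ SamePair c (v i) l ∧ ¬ SamePair c (v j) (b j)) ∧
      1 ≤ num W (fun v => SamePair c (v i) l ∧ ¬ SamePair c (v j) (b j)) := by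
  obtain ⟨v, hv, w, hw, hvl, hwl, hvw⟩ := h.cross' hi ha hal
  obtain ⟨-, -, h3⟩ := h.four_le_meeting hi hv hvl hw hwl hvw
  have key : ∀ m, (∀ s, SamePair c s m ↔ SamePair c s l) → (sl V i m).card = 2 →
      (sl V i (c m)).card ≤ 3 → ∃ j ∈ J.erase i, ∃ b ∈ V,
      3 ≤ num V (fun v => SamePair c (v i) l ∧ SamePair c (v j) (b j)) ∧
      1 ≤ num V (fun v => SamePair c (v i) l ∧ ¬ SamePair c (v j) (b j)) ∧
      3 ≤ num V (fun v => ¬ SamePair c (v i) l ∧ SamePair c (v j) (b j)) ∧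
      4 ≤ num W (fun v => ¬ SamePair c (v i) l ∧ ¬ SamePair c (v j) (b j)) ∧
      1 ≤ num W (fun v => SamePair c (v i) l ∧ ¬ SamePair c (v j) (b j)) := by
    intro m hm h2 h3
    obtain ⟨p, q, hpq, hs⟩ := Finset.card_eq_two.1 h2
    have hp : p ∈ sl V i m := by simp [hs]
    have hq : q ∈ sl V i m := by simp [hs]
    obtain ⟨j, hj, hjpq⟩ := (h.left.sl i m).dich p hp q hq hpq
    have := (Small.mk h hi hj hp hq (by simp [hs]) hjpq h3).cells
    simp only [hm] at this
    exact ⟨j, hj, p, (mem_sl.1 hp).1, this⟩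
  have h4 := Finset.card_le_card (meeting_subset (c := c) (J.erase i) (sl V i l) w)
  have h5 := Finset.card_le_card (meeting_subset (c := c) (J.erase i) (sl V i (c l)) w)
  rw [num_samePair'] at hle
  have h6 : 0 < (sl V i l).card ∧ 0 < (sl V i (c l)).card := by
    obtain ⟨⟨a, ha, -⟩, ⟨b, hb, -⟩, -⟩ := h.four_le_meeting hi hv hvl hw hwl hvw
    exact ⟨Finset.card_pos.2 ⟨a, ha⟩, Finset.card_pos.2 ⟨b, hb⟩⟩
  by_cases h7 : (sl V i l).card ≤ 2
  · exact key l (fun _ => Iff.rfl) (by omega) (by omega)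
  · refine key (c l) (fun _ => samePair_compl) (by omega) ?_
    rw [Complementation.invol (c := c)]
    omega

end Cells

section Counting

variable {ι : Type} {c : S → S}

theorem num_cells (V : Finset (ι → S)) (f g : (ι → S) → Prop) :
    num V (fun v => f v ∧ g v) + num V (fun v => f v ∧ ¬ g v) = num V (fun v => f v) ∧
    num V (fun v => ¬ f v ∧ g v) + num V (fun v => ¬ f v ∧ ¬ g v) = num V (fun v => ¬ f v) ∧
    num V (fun v => f v ∧ g v) + num V (fun v => ¬ f v ∧ g v) = num V (fun v => g v) ∧
    num V (fun v => f v ∧ ¬ g v) + num V (fun v => ¬ f v ∧ ¬ g v) = num V (fun v => ¬ g v) ∧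
    num V (fun v => f v) + num V (fun v => ¬ f v) = V.card ∧
    num V (fun v => g v) + num V (fun v => ¬ g v) = V.card := by
  have hcomm : ∀ f g : (ι → S) → Prop, num V (fun v => f v ∧ g v) = num V (fun v => g v ∧ f v) :=
    fun f g => num_congr fun _ _ => and_comm
  refine ⟨num_add_num V f g, num_add_num V (fun v => ¬ f v) g, ?_, ?_, num_compl V f,
    num_compl V g⟩
  · rw [hcomm f g, hcomm (fun v => ¬ f v) g]
    exact num_add_num V g f
  · rw [hcomm f (fun v => ¬ g v), hcomm (fun v => ¬ f v) (fun v => ¬ g v)]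
    exact num_add_num V (fun v => ¬ g v) f

variable [Complementation c] {J : Finset ι} {V W : Finset (ι → S)} {i j : ι} {l : S}

theorem Crit.exists_other (h : Crit c J V W) (hi : i ∈ J) {a : ι → S} (ha : a ∈ V ∨ a ∈ W)
    (hal : SamePair c (a i) l) : ∃ b ∈ V, ¬ SamePair c (b i) l ∧
      ∀ u, u ∈ V ∨ u ∈ W → (SamePair c (u i) (b i) ↔ ¬ SamePair c (u i) l) := by
  obtain ⟨-, -, b, hb, -, hbl, -⟩ := h.cross hi ha hal
  refine ⟨b, hb, hbl, fun u hu => ⟨fun hub hul => hbl (samePair_trans (samePair_symm hub) hul),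
    fun hul => ?_⟩⟩
  refine (h.samePair_or hi ha (Or.inl hb) hu
    (fun h' => hbl (samePair_trans h' hal))).resolve_left fun h' => hul (samePair_trans h' hal)

theorem Crit.nonempty_positions (h : Crit c J V W) : J.Nonempty := by
  obtain ⟨v, hv⟩ := h.nonempty
  obtain ⟨w, hw⟩ := h.symm.nonempty
  rw [Finset.nonempty_iff_ne_empty]
  rintro rfl
  exact h.disj v hv w hw fun j hj => absurd hj (Finset.notMem_empty j)

theorem Crit.exists_le_five (h : Crit c J V W) (hi : i ∈ J) :
    ∃ a ∈ V, num V (fun v => SamePair c (v i) (a i)) ≤ 5 := by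
  obtain ⟨a, ha⟩ := h.nonempty
  obtain ⟨b, hb, -, hb'⟩ := h.exists_other hi (Or.inl ha) (samePair_self _)
  have h1 : num V (fun v => SamePair c (v i) (b i)) = num V (fun v => ¬ SamePair c (v i) (a i)) :=
    num_congr fun v hv => hb' v (Or.inl hv)
  have h2 := num_compl V (fun v => SamePair c (v i) (a i))
  have h3 := h.card_le
  by_cases h4 : num V (fun v => SamePair c (v i) (a i)) ≤ 5
  · exact ⟨a, ha, h4⟩
  · exact ⟨b, hb, by omega⟩

/-- Some letter pair occurs exactly four times at some position in one of the codes. -/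
theorem Crit.exists_eq_four (h : Crit c J V W) : ∃ i ∈ J, ∃ a, (a ∈ V ∨ a ∈ W) ∧
    (num V (fun v => SamePair c (v i) (a i)) = 4 ∨
      num W (fun v => SamePair c (v i) (a i)) = 4) := by
  by_contra! hno
  have key : ∀ i ∈ J, ∀ a, (a ∈ V ∨ a ∈ W) →
      5 ≤ num V (fun v => SamePair c (v i) (a i)) ∧
      5 ≤ num V (fun v => ¬ SamePair c (v i) (a i)) ∧
      5 ≤ num W (fun v => SamePair c (v i) (a i)) ∧
      5 ≤ num W (fun v => ¬ SamePair c (v i) (a i)) := by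
    intro i hi a ha
    have h1 := h.four_le_num_samePair hi ha (samePair_self _)
    have h2 := h.symm.four_le_num_samePair hi ha.symm (samePair_self _)
    obtain ⟨b, hb, -, hb'⟩ := h.exists_other hi ha (samePair_self _)
    have h3 := hno i hi a ha
    have h4 := hno i hi b (Or.inl hb)
    have h5 : num V (fun v => SamePair c (v i) (b i)) = num V (fun v => ¬ SamePair c (v i) (a i)) :=
      num_congr fun v hv => hb' v (Or.inl hv)
    have h6 : num W (fun v => SamePair c (v i) (b i)) = num W (fun v => ¬ SamePair c (v i) (a i)) :=
      num_congr fun v hv => hb' v (Or.inr hv)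
    omega
  obtain ⟨i, hi⟩ := h.nonempty_positions
  obtain ⟨a, ha, ha5⟩ := h.exists_le_five hi
  obtain ⟨j, hj, b, hb, h1, h2, h3, h4, h5⟩ := h.exists_cells hi (Or.inl ha) (samePair_self _) ha5
  rw [Finset.mem_erase] at hj
  have h6 := key i hi a (Or.inl ha)
  have h7 := key j hj.2 b (Or.inl hb)
  have h8 := num_cells V (fun v => SamePair c (v i) (a i)) (fun v => SamePair c (v j) (b j))
  have h9 := num_cells W (fun v => SamePair c (v i) (a i)) (fun v => SamePair c (v j) (b j))
  have h10 := (h.even_num hi (a i)).two_dvd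
  have h11 := (h.even_num hj.2 (b j)).two_dvd
  have h12 := (h.even_num_and hi hj.2 hj.1 (a i) (b j)).two_dvd
  have h13 := h.card_le
  have h14 := h.toSys.card_eq
  omega

/-- The frequencies forced by a letter pair that occurs four times. -/
theorem Crit.exists_cells_of_eq_four (h : Crit c J V W) (hi : i ∈ J) {a : ι → S}
    (ha : a ∈ V ∨ a ∈ W) (hal : SamePair c (a i) l)
    (h4 : num V (fun v => SamePair c (v i) l) = 4) :
    (num W (fun v => SamePair c (v i) l) = 4 ∧ 10 ≤ V.card) ∨
      (num W (fun v => SamePair c (v i) l) = 6 ∧ V.card = 11) := by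
  obtain ⟨j, hj, b, hb, h1, h2, h3, h4, h5⟩ := h.exists_cells hi ha hal (by omega)
  rw [Finset.mem_erase] at hj
  have h6 := h.four_le_num_samePair hi ha hal
  have h7 := h.symm.four_le_num_samePair hi ha.symm hal
  have h6' := h.four_le_num_samePair hj.2 (Or.inl hb) (samePair_self _)
  have h7' := h.symm.four_le_num_samePair hj.2 (Or.inr hb) (samePair_self _)
  have h8 := num_cells V (fun v => SamePair c (v i) l) (fun v => SamePair c (v j) (b j))
  have h9 := num_cells W (fun v => SamePair c (v i) l) (fun v => SamePair c (v j) (b j))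
  have h10 := (h.even_num hi l).two_dvd
  have h11 := (h.even_num hj.2 (b j)).two_dvd
  have h12 := (h.even_num_and hi hj.2 hj.1 l (b j)).two_dvd
  have h13 := h.card_le
  have h14 := h.toSys.card_eq
  omega

end Counting

section Quad

variable {ι : Type} {c : S → S}

theorem countP_single {α : Type} (f : α → Prop) (a : α) :
    ({a} : Multiset α).countP f = if f a then 1 else 0 := by
  rw [← Multiset.cons_zero, Multiset.countP_cons, Multiset.countP_zero, zero_add]

theorem Rel.of_add {K : Finset ι} {M N P R : Multiset (ι → S)} {A B : ι → S}
    (h : Rel c K (P + {B}) (R + {A})) (h' : Rel c K (P + N) (M + R)) :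
    Rel c K (M + {B}) (N + {A}) := fun x hx => by
  have h1 := h x hx
  have h2 := h' x hx
  simp only [Multiset.countP_add] at h1 h2 ⊢
  omega

variable [Complementation c]

/-- If two pairs of words cover the same points, and `A` differs from `B` at two positions, then
the partner of `B` agrees with `A`. -/
theorem Rel.agreeOn_of_pair {K : Finset ι} {A B s t : ι → S}
    (h : Rel c K ({s} + {B}) ({t} + {A})) {j k : ι} (hj : j ∈ K) (hk : k ∈ K) (hjk : j ≠ k)
    (hABj : A j ≠ B j) (hABk : A k ≠ B k) : AgreeOn K s A := by
  intro m hm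
  by_contra hne
  have hpt : ∀ n, ∃ E ∈ ESet c, A n ∈ E ∧ (n = m → s n ∉ E) ∧ (n ≠ m → A n ≠ B n → B n ∉ E) := by
    intro n
    have key : ∀ r, r ≠ A n → ∃ E ∈ ESet c, A n ∈ E ∧ r ∉ E := fun r hr => by
      obtain ⟨E, hE, h1, h2⟩ := exists_eSet_pair (c := c) (s := A n) (t := c r) (compl_ne_compl hr)
      exact ⟨E, hE, h1, (compl_mem_iff hE r).1 h2⟩
    by_cases hnm : n = m
    · obtain ⟨E, hE, h1, h2⟩ := key (s n) (hnm ▸ hne)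
      exact ⟨E, hE, h1, fun _ => h2, fun h' => absurd hnm h'⟩
    by_cases hAB : A n = B n
    · obtain ⟨E, hE, h1, -⟩ := key (c (A n)) (Complementation.ne (c := c) _)
      exact ⟨E, hE, h1, fun h' => absurd h' hnm, fun _ h' => absurd hAB h'⟩
    · obtain ⟨E, hE, h1, h2⟩ := key (B n) (Ne.symm hAB)
      exact ⟨E, hE, h1, fun h' => absurd h' hnm, fun _ _ => h2⟩
  choose x hx hxA hxs hxB using hpt
  have hA : MemOn K x A := fun n _ => hxA n
  have hs : ¬ MemOn K x s := fun h' => hxs m rfl (h' m hm)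
  have hB : ¬ MemOn K x B := fun h' => by
    by_cases hjm : j = m
    · exact hxB k (fun h'' => hjk (hjm.trans h''.symm)) hABk (h' k hk)
    · exact hxB j hjm hABj (h' j hj)
  have := h x hx
  simp only [Multiset.countP_add, countP_single, hA, hs, hB, if_true, if_false] at this
  omega

/-- The shape of the words of `V` with a letter from the pair of `l` at `i` when there are four
of them. -/
structure Quad (c : S → S) (J : Finset ι) (V W : Finset (ι → S)) (i j k : ι) (l : S)
    (p q r s : ι → S) : Prop where
  crit : Crit c J V W
  hi : i ∈ J
  hj : j ∈ J.erase i
  hk : k ∈ (J.erase i).erase j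
  left_eq : sl V i l = {p, q}
  right_eq : sl V i (c l) = {r, s}
  q_j : q j = c (p j)
  s_j : s j = p j
  r_k : r k = q k
  s_k : s k = c (q k)
  not_samePair_j : ¬ SamePair c (r j) (p j)
  not_samePair_k : ¬ SamePair c (p k) (q k)
  agree_p : AgreeOn (((J.erase i).erase j).erase k) p q
  agree_r : AgreeOn (((J.erase i).erase j).erase k) r q
  agree_s : AgreeOn (((J.erase i).erase j).erase k) s q
  eq_of_meet : ∀ v ∈ V, SamePair c (v i) l → ∀ w ∈ W, ¬ SamePair c (w i) l →
    ¬ DichoOn c (J.erase i) v w → w j = r j ∧ w k = p k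

variable {J : Finset ι} {V W : Finset (ι → S)} {i j k : ι} {l : S} {p q r s : ι → S}

theorem Small.quad_of_eq (h : Small c J V W i j l p q) (hr : r ∈ sl V i (c l))
    (hs : s ∈ sl V i (c l)) (hrs : sl V i (c l) = {r, s}) {e : ι → S} (he : e ∈ W)
    (hel : ¬ SamePair c (e i) l) (hpe : ¬ DichoOn c (J.erase i) p e) (hrj : r j = e j)
    (hsj : s j = p j) : ∃ k, Quad c J V W i j k l p q r s := by
  have hne := Complementation.ne (c := c)
  have hpl : SamePair c (p i) l := Or.inl h.p_i
  have heb := h.not_samePair h.p_mem hpl he hel hpe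
  have hmem : ∀ z ∈ sl V i (c l), z = r ∨ z = s := fun z hz => by
    rw [hrs] at hz
    simpa using hz
  have hr_ne_s : r ≠ s := by
    rintro rfl
    exact heb (Or.inl (by rw [← hrj, hsj]))
  have hagr : AgreeOn ((J.erase i).erase j) r q := by
    obtain ⟨r', hr', hr'j, -, -, -, h2⟩ := h.exists_crossing h.p_mem hpl he hel hpe
    have : r' = r := (hmem r' hr').resolve_right (by
      rintro rfl
      exact heb (Or.inl (by rw [← hr'j, hsj])))
    subst this
    refine h2 fun z hz hzq => ?_
    rw [h.compl] at hzq
    rcases hmem z hz with rfl | rfl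
    · exact heb (Or.inr (by rw [← hrj, hzq]))
    · exact hne _ (hzq.symm.trans hsj)
  have hmeet : ∀ w ∈ W, ¬ SamePair c (w i) l → (∃ v ∈ V, SamePair c (v i) l ∧
      ¬ DichoOn c (J.erase i) v w) → w j = r j ∧ ¬ DichoOn c (J.erase i) r w ∧
      ¬ DichoOn c (J.erase i) s w ∧ ∀ x, Transversal c x → MemOn ((J.erase i).erase j) x w →
        (MemOn ((J.erase i).erase j) x p ↔
          MemOn ((J.erase i).erase j) x r ∨ MemOn ((J.erase i).erase j) x s) := by
    rintro w hw hwl ⟨v, hv, hvl, hvw⟩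
    have hwb := h.not_samePair hv hvl hw hwl hvw
    obtain ⟨r', hr', hr'j, -⟩ := h.exists_crossing hv hvl hw hwl hvw
    have : r' = r := (hmem r' hr').resolve_right (by
      rintro rfl
      exact hwb (Or.inl (by rw [← hr'j, hsj])))
    subst this
    obtain ⟨-, -, h2⟩ := h.not_dichoOn hv hvl hw hwl hvw
    have h3 : meeting c (J.erase i) (sl V i (c l)) w = sl V i (c l) :=
      Finset.eq_of_subset_of_card_le (meeting_subset _ _ _)
        (by rw [hrs, Finset.card_pair hr_ne_s, ← hrs]; exact h2)
    refine ⟨hr'j.symm, (mem_meeting.1 (h3 ▸ hr)).2, (mem_meeting.1 (h3 ▸ hs)).2,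
      fun x hx hxw => ?_⟩
    rw [h.cov_iff hv hvl hw hwl hvw hx hxw]
    constructor
    · rintro ⟨z, hz, -, hxz⟩
      rcases hmem z hz with rfl | rfl
      · exact Or.inl hxz
      · exact Or.inr hxz
    · rintro (hxz | hxz)
      · exact ⟨_, hr, Or.inr hr'j, hxz⟩
      · exact ⟨_, hs, Or.inl hsj, hxz⟩
  have hsub := Finset.erase_subset j (J.erase i)
  obtain ⟨-, hre, hse, hcov⟩ := hmeet e he hel ⟨p, h.p_mem, hpl, hpe⟩
  have htwin : TwinOn c ((J.erase i).erase j) r s := by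
    by_contra hno
    have hdich : DichoOn c ((J.erase i).erase j) r s := by
      obtain ⟨m, hm, hmrs⟩ := (h.crit.left.sl i (c l)).dich r hr s hs hr_ne_s
      refine ⟨m, Finset.mem_erase.2 ⟨?_, hm⟩, hmrs⟩
      rintro rfl
      exact heb (samePair_symm (Or.inr (by rw [← hsj, hmrs, hrj])))
    have htf : TwinFree c ((J.erase i).erase j) {r, s} := by
      have hself : ∀ z, ¬ TwinOn c ((J.erase i).erase j) z z := by
        rintro z ⟨m, hm, h1, -⟩
        exact hne _ h1.symm
      have hsym : ¬ TwinOn c ((J.erase i).erase j) s r := by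
        rintro ⟨m, hm, h1, h2⟩
        exact hno ⟨m, hm, by rw [h1, Complementation.invol (c := c)],
          fun n hn hnm => (h2 n hn hnm).symm⟩
      constructor
      · intro a ha b hb hab
        simp only [Finset.mem_insert, Finset.mem_singleton] at ha hb
        rcases ha with rfl | rfl <;> rcases hb with rfl | rfl
        · exact absurd rfl hab
        · exact hdich
        · exact hdich.symm
        · exact absurd rfl hab
      · intro a ha b hb
        simp only [Finset.mem_insert, Finset.mem_singleton] at ha hb
        rcases ha with rfl | rfl <;> rcases hb with rfl | rfl
        · exact hself _
        · exact hno
        · exact hsym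
        · exact hself _
    have h5 := local_bound (K := (J.erase i).erase j) (D := {r, s}) (u := p) (w := e) htf
      (fun h' => hpe (h'.mono hsub)) (fun x hx hxe => by
        rw [hcov x hx hxe]
        simp [Cov]) (by
        intro d hd hdp
        simp only [Finset.mem_insert, Finset.mem_singleton] at hd
        rcases hd with rfl | rfl
        · refine (h.crit.left.sl i l).not_agreeOn h.hj h.hp h.hq h.compl fun n hn => ?_
          rw [← hdp n hn, hagr n hn]
        · exact h.right_not_agreeOn hs hsj hdp)
    have h6 := Finset.card_le_card (meeting_subset (c := c) ((J.erase i).erase j) {r, s} e)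
    have h7 := Finset.card_le_two (a := r) (b := s)
    omega
  obtain ⟨k, hk, hrsk, hrs'⟩ := htwin
  have hsr : AgreeOn (((J.erase i).erase j).erase k) s r := fun n hn =>
    hrs' n (Finset.mem_of_mem_erase hn) (Finset.mem_erase.1 hn).1
  have hpk : ∀ w ∈ W, ¬ SamePair c (w i) l → (∃ v ∈ V, SamePair c (v i) l ∧
      ¬ DichoOn c (J.erase i) v w) → p k = w k := by
    intro w hw hwl hv
    obtain ⟨-, hrw, hsw, hcov⟩ := hmeet w hw hwl hv
    have h1 := eq_or_eq_of_subset (a := r) (b := p) (w := w) (fun h' => hrw (h'.mono hsub))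
      (fun x hx hxw hxr => (hcov x hx hxw).2 (Or.inl hxr)) hk
    have h2 := eq_or_eq_of_subset (a := s) (b := p) (w := w) (fun h' => hsw (h'.mono hsub))
      (fun x hx hxw hxr => (hcov x hx hxw).2 (Or.inr hxr)) hk
    rcases h1 with h1 | h1
    · rcases h2 with h2 | h2
      · rw [h1, hrsk] at h2
        exact absurd h2.symm (hne _)
      · exact h2
    · exact h1
  have hpke := hpk e he hel ⟨p, h.p_mem, hpl, hpe⟩
  have hkK := Finset.mem_of_mem_erase hk
  have hek : ¬ SamePair c (e k) (r k) := by
    rintro (h' | h')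
    · exact hse ⟨k, hkK, by rw [hrsk, Complementation.invol (c := c), h']⟩
    · exact hre ⟨k, hkK, h'⟩
  have hagp : AgreeOn (((J.erase i).erase j).erase k) p r := by
    have hsub' := Finset.erase_subset k ((J.erase i).erase j)
    refine agreeOn_of_box_eq (w := e) (fun h' => hpe (h'.mono (hsub'.trans hsub)))
      (fun h' => hre (h'.mono (hsub'.trans hsub))) fun x hx hxe => ?_
    obtain ⟨B, hB, hB1, -⟩ := exists_eSet_pair (c := c) (s := e k) (t := e k) (hne _).symm
    have := hcov _ (transversal_update hx k hB) ((memOn_update_iff hk).2 ⟨hB1, hxe⟩)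
    simp only [memOn_update_iff hk] at this
    constructor
    · intro hxp
      rcases this.1 ⟨hpke ▸ hB1, hxp⟩ with h' | h'
      · exact h'.2
      · exact hsr.mem h'.2
    · intro hxr
      refine (this.2 ?_).2
      by_cases hrB : r k ∈ B
      · exact Or.inl ⟨hrB, hxr⟩
      · refine Or.inr ⟨?_, hsr.symm.mem hxr⟩
        rw [hrsk, compl_mem_iff hB]
        exact hrB
  have hagr' : AgreeOn (((J.erase i).erase j).erase k) r q := fun n hn =>
    hagr n (Finset.mem_of_mem_erase hn)
  refine ⟨k, h.crit, h.hi, h.hj, hk, ?_, hrs, h.compl, hsj, hagr k hk, ?_, ?_, ?_, ?_, hagr', ?_, ?_⟩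
  · ext z
    simp only [Finset.mem_insert, Finset.mem_singleton]
    refine ⟨h.eq_or z, ?_⟩
    rintro (rfl | rfl)
    · exact h.hp
    · exact h.hq
  · rw [hrsk, hagr k hk]
  · rw [hrj]
    exact heb
  · rw [hpke, ← hagr k hk]
    exact hek
  · exact fun n hn => (hagp n hn).trans (hagr' n hn)
  · exact fun n hn => (hsr n hn).trans (hagr' n hn)
  · exact fun v hv hvl w hw hwl hvw => ⟨(hmeet w hw hwl ⟨v, hv, hvl, hvw⟩).1,
      (hpk w hw hwl ⟨v, hv, hvl, hvw⟩).symm⟩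

theorem Crit.exists_quad (h : Crit c J V W) (hi : i ∈ J) {a : ι → S} (ha : a ∈ V ∨ a ∈ W)
    (hal : SamePair c (a i) l) (h4 : num V (fun v => SamePair c (v i) l) = 4) :
    ∃ j k p q r s, Quad c J V W i j k l p q r s := by
  obtain ⟨v, hv, w, hw, hvl, hwl, hvw⟩ := h.cross' hi ha hal
  obtain ⟨-, -, h3⟩ := h.four_le_meeting hi hv hvl hw hwl hvw
  have h5 := Finset.card_le_card (meeting_subset (c := c) (J.erase i) (sl V i l) w)
  have h6 := Finset.card_le_card (meeting_subset (c := c) (J.erase i) (sl V i (c l)) w)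
  rw [num_samePair'] at h4
  obtain ⟨p, q, hpq, hP⟩ := Finset.card_eq_two.1 (by omega : (sl V i l).card = 2)
  have hp : p ∈ sl V i l := by simp [hP]
  have hq : q ∈ sl V i l := by simp [hP]
  obtain ⟨j, hj, hjpq⟩ := (h.left.sl i l).dich p hp q hq hpq
  have hS : Small c J V W i j l p q := ⟨h, hi, hj, hp, hq, by simp [hP], hjpq, by omega⟩
  obtain ⟨r, hr, hrj, -, ⟨s, hs, hsj, -⟩, -⟩ := hS.exists_crossing hv hvl hw hwl hvw
  have hwb := hS.not_samePair hv hvl hw hwl hvw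
  have hrs : sl V i (c l) = {r, s} := by
    refine (Finset.eq_of_subset_of_card_le ?_ ?_).symm
    · intro z hz
      simp only [Finset.mem_insert, Finset.mem_singleton] at hz
      rcases hz with rfl | rfl <;> assumption
    · rw [Finset.card_pair]
      · omega
      · rintro rfl
        exact hwb (hrj ▸ hsj)
  obtain ⟨h7, h8, -⟩ := hS.not_dichoOn hv hvl hw hwl hvw
  rcases hsj with hsj | hsj
  · obtain ⟨k, hk⟩ := hS.quad_of_eq hr hs hrs hw hwl h7 hrj hsj
    exact ⟨j, k, p, q, r, s, hk⟩
  · obtain ⟨k, hk⟩ := hS.swap.quad_of_eq hr hs hrs hw hwl h8 hrj (by rw [hsj, hjpq])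
    exact ⟨j, k, q, p, r, s, hk⟩

end Quad

section Balanced

variable {ι : Type} {c : S → S} {J : Finset ι} {V W : Finset (ι → S)}
  {i j k : ι} {l : S} {p q r s : ι → S}

theorem Quad.p_mem (h : Quad c J V W i j k l p q r s) : p ∈ V ∧ p i = l :=
  mem_sl.1 (h.left_eq ▸ Finset.mem_insert_self _ _)

theorem Quad.q_mem (h : Quad c J V W i j k l p q r s) : q ∈ V ∧ q i = l :=
  mem_sl.1 (h.left_eq ▸ Finset.mem_insert_of_mem (Finset.mem_singleton_self _))

theorem Quad.r_mem (h : Quad c J V W i j k l p q r s) : r ∈ V ∧ r i = c l :=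
  mem_sl.1 (h.right_eq ▸ Finset.mem_insert_self _ _)

theorem Quad.s_mem (h : Quad c J V W i j k l p q r s) : s ∈ V ∧ s i = c l :=
  mem_sl.1 (h.right_eq ▸ Finset.mem_insert_of_mem (Finset.mem_singleton_self _))

theorem Quad.j_ne_k (h : Quad c J V W i j k l p q r s) : j ≠ k :=
  (Finset.ne_of_mem_erase h.hk).symm

theorem Quad.k_mem (h : Quad c J V W i j k l p q r s) : k ∈ J.erase i :=
  Finset.mem_of_mem_erase h.hk

/-- The word with the complement of the letter of `r` at `j`. -/
noncomputable def flip (c : S → S) (j : ι) (r : ι → S) : ι → S := Function.update r j (c (r j))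

theorem flip_self (j : ι) (r : ι → S) : flip c j r j = c (r j) := Function.update_self ..

theorem flip_of_ne {j m : ι} (h : m ≠ j) (r : ι → S) : flip c j r m = r m :=
  Function.update_of_ne h ..

theorem Quad.flip_agreeOn (h : Quad c J V W i j k l p q r s) {m : ι} (hm : m ∈ J.erase i)
    (hmj : m ≠ j) (hmk : m ≠ k) : flip c j r m = q m ∧ flip c k p m = q m := by
  rw [flip_of_ne hmj, flip_of_ne hmk]
  have hm' : m ∈ ((J.erase i).erase j).erase k :=
    Finset.mem_erase.2 ⟨hmk, Finset.mem_erase.2 ⟨hmj, hm⟩⟩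
  exact ⟨h.agree_r m hm', h.agree_p m hm'⟩

variable [Complementation c]

theorem Quad.flip_ne_j (h : Quad c J V W i j k l p q r s) : flip c j r j ≠ flip c k p j := by
  rw [flip_self, flip_of_ne h.j_ne_k]
  exact fun h' => h.not_samePair_j (Or.inr (by rw [← h', Complementation.invol (c := c)]))

theorem Quad.flip_ne_k (h : Quad c J V W i j k l p q r s) : flip c j r k ≠ flip c k p k := by
  rw [flip_self, flip_of_ne h.j_ne_k.symm, h.r_k]
  exact fun h' => h.not_samePair_k (samePair_symm (Or.inr h'))

omit [Complementation c] in
theorem Quad.eq_or_eq (h : Quad c J V W i j k l p q r s) {m : ι} (hm : m ∈ J.erase i)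
    (hne : flip c j r m ≠ flip c k p m) : m = j ∨ m = k := by
  by_contra! h'
  obtain ⟨h1, h2⟩ := h.flip_agreeOn hm h'.1 h'.2
  exact hne (h1.trans h2.symm)

theorem Quad.rel_left (h : Quad c J V W i j k l p q r s) :
    Rel c (J.erase i) ((sl V i l).val + {flip c k p}) ((sl V i (c l)).val + {flip c j r}) := by
  have hne := Complementation.ne (c := c)
  have hval : ∀ {a b : ι → S}, a ≠ b → ({a, b} : Finset (ι → S)).val = {a} + {b} := fun hab => by
    rw [Finset.insert_val_of_notMem (by simpa using hab), Finset.singleton_val,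
      ← Multiset.singleton_add]
  have hpq : p ≠ q := by
    rintro rfl
    exact hne _ h.q_j.symm
  have hrs : r ≠ s := by
    rintro rfl
    exact hne _ (h.s_k.symm.trans h.r_k)
  rw [h.left_eq, h.right_eq, hval hpq, hval hrs]
  intro x hx
  have hp : MemOn (((J.erase i).erase j).erase k) x p ↔
      MemOn (((J.erase i).erase j).erase k) x q := ⟨h.agree_p.mem, h.agree_p.symm.mem⟩
  have hr : MemOn (((J.erase i).erase j).erase k) x r ↔
      MemOn (((J.erase i).erase j).erase k) x q := ⟨h.agree_r.mem, h.agree_r.symm.mem⟩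
  have hs : MemOn (((J.erase i).erase j).erase k) x s ↔
      MemOn (((J.erase i).erase j).erase k) x q := ⟨h.agree_s.mem, h.agree_s.symm.mem⟩
  have hk : ∀ m ∈ ((J.erase i).erase j).erase k, m ∈ J.erase i ∧ m ≠ j ∧ m ≠ k := fun m hm => by
    simp only [Finset.mem_erase] at hm ⊢
    tauto
  have hA : AgreeOn (((J.erase i).erase j).erase k) (flip c j r) q := fun m hm =>
    (h.flip_agreeOn (hk m hm).1 (hk m hm).2.1 (hk m hm).2.2).1
  have hB : AgreeOn (((J.erase i).erase j).erase k) (flip c k p) q := fun m hm =>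
    (h.flip_agreeOn (hk m hm).1 (hk m hm).2.1 (hk m hm).2.2).2
  have hA' : MemOn (((J.erase i).erase j).erase k) x (flip c j r) ↔
      MemOn (((J.erase i).erase j).erase k) x q := ⟨hA.mem, hA.symm.mem⟩
  have hB' : MemOn (((J.erase i).erase j).erase k) x (flip c k p) ↔
      MemOn (((J.erase i).erase j).erase k) x q := ⟨hB.mem, hB.symm.mem⟩
  simp only [Multiset.countP_add, countP_single]
  simp only [memOn_iff h.hj, memOn_iff h.hk, hp, hr, hs, hA',
    hB', flip_self, flip_of_ne h.j_ne_k, flip_of_ne h.j_ne_k.symm, h.q_j, h.s_j, h.r_k, h.s_k,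
    compl_mem_iff (hx j), compl_mem_iff (hx k)]
  by_cases h1 : p j ∈ x j <;> by_cases h2 : r j ∈ x j <;> by_cases h3 : q k ∈ x k <;>
    by_cases h4 : p k ∈ x k <;> by_cases h5 : MemOn (((J.erase i).erase j).erase k) x q <;>
    simp [h1, h2, h3, h4, h5]

theorem Quad.rel_right (h : Quad c J V W i j k l p q r s) :
    Rel c (J.erase i) ((sl W i l).val + {flip c k p}) ((sl W i (c l)).val + {flip c j r}) :=
  h.rel_left.of_add (h.crit.toSys.rel_sl h.hi l)

theorem Quad.num_j (h : Quad c J V W i j k l p q r s) :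
    3 ≤ num V (fun v => SamePair c (v i) l ∧ SamePair c (v j) (p j)) ∧
    1 ≤ num V (fun v => SamePair c (v i) l ∧ ¬ SamePair c (v j) (p j)) := by
  have hne := Complementation.ne (c := c)
  have hs : ∀ a, a i = l → a ≠ s := by
    rintro a ha rfl
    exact hne _ (h.s_mem.2.symm.trans ha)
  refine ⟨three_le_num h.p_mem.1 h.q_mem.1 h.s_mem.1 ⟨Or.inl h.p_mem.2, samePair_self _⟩
    ⟨Or.inl h.q_mem.2, Or.inr h.q_j⟩ ⟨Or.inr h.s_mem.2, Or.inl h.s_j⟩ ?_ (hs _ h.p_mem.2)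
    (hs _ h.q_mem.2), num_pos h.r_mem.1 ⟨Or.inr h.r_mem.2, h.not_samePair_j⟩⟩
  rintro rfl
  exact hne _ h.q_j.symm

theorem Quad.num_k (h : Quad c J V W i j k l p q r s) :
    3 ≤ num V (fun v => SamePair c (v i) l ∧ SamePair c (v k) (q k)) := by
  have hne := Complementation.ne (c := c)
  have hq : ∀ a, a i = c l → q ≠ a := by
    rintro a ha rfl
    exact hne _ (ha.symm.trans h.q_mem.2)
  refine three_le_num h.q_mem.1 h.r_mem.1 h.s_mem.1 ⟨Or.inl h.q_mem.2, samePair_self _⟩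
    ⟨Or.inr h.r_mem.2, Or.inl h.r_k⟩ ⟨Or.inr h.s_mem.2, Or.inr h.s_k⟩ (hq _ h.r_mem.2)
    (hq _ h.s_mem.2) ?_
  rintro rfl
  exact hne _ (h.s_k.symm.trans h.r_k)

theorem Quad.four_le_num (h : Quad c J V W i j k l p q r s) :
    4 ≤ num W (fun v => ¬ SamePair c (v i) l ∧ v j = r j ∧ v k = p k) := by
  obtain ⟨v, hv, w, hw, hvl, hwl, hvw⟩ := h.crit.cross' h.hi (Or.inl h.p_mem.1) (Or.inl h.p_mem.2)
  refine (h.crit.toSys.symm.four_le_num_and h.hi hw (samePair_self _) hv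
    (fun h' => hwl (samePair_trans (samePair_symm h') hvl)) (fun h' => hvw h'.symm)).trans
    (num_mono fun u hu hu' => ?_)
  have hul : ¬ SamePair c (u i) l := fun h' =>
    hwl (samePair_trans (samePair_symm hu'.2) h')
  exact ⟨hul, h.eq_of_meet v hv hvl u hu hul fun h' => hu'.1 h'.symm⟩

/-- A letter pair cannot occur four times in both codes. -/
theorem Quad.false_of_quad {j' k' : ι} {p' q' r' s' : ι → S}
    (h : Quad c J V W i j k l p q r s) (h' : Quad c J W V i j' k' l p' q' r' s')
    (h4 : num V (fun v => SamePair c (v i) l) = 4)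
    (h4' : num W (fun v => SamePair c (v i) l) = 4) : False := by
  have hinv := Complementation.invol (c := c)
  have hinj : ∀ {a b : S}, c a = c b → a = b := fun {a b} hab => by rw [← hinv a, hab, hinv]
  have hrel : Rel c (J.erase i) ({flip c j' r'} + {flip c k p})
      ({flip c k' p'} + {flip c j r}) := fun x hx => by
    have h1 := h.rel_right x hx
    have h2 := h'.rel_left x hx
    simp only [Multiset.countP_add] at h1 h2 ⊢
    omega
  have hA := hrel.agreeOn_of_pair h.hj h.k_mem h.j_ne_k h.flip_ne_j h.flip_ne_k
  have hB := hrel.symm.agreeOn_of_pair h.hj h.k_mem h.j_ne_k h.flip_ne_j.symm h.flip_ne_k.symm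
  have hj' : j' = j ∨ j' = k := h.eq_or_eq h'.hj (by
    rw [← hA j' h'.hj, ← hB j' h'.hj]
    exact h'.flip_ne_j)
  have hk' : k' = j ∨ k' = k := h.eq_or_eq h'.k_mem (by
    rw [← hA k' h'.k_mem, ← hB k' h'.k_mem]
    exact h'.flip_ne_k)
  have hBj := hB j h.hj
  have hBk := hB k h.k_mem
  have hjk := h.j_ne_k
  rcases hj' with rfl | rfl <;> rcases hk' with rfl | rfl
  · exact h'.j_ne_k rfl
  · refine h.crit.disj p h.p_mem.1 p' h'.p_mem.1 fun m hm => ?_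
    by_cases hmi : m = i
    · rw [hmi, h.p_mem.2, h'.p_mem.2]
    have hm' := hB m (Finset.mem_erase.2 ⟨hmi, hm⟩)
    by_cases hmk : m = k'
    · subst hmk
      rw [flip_self, flip_self] at hm'
      exact (hinj hm').symm
    · rwa [flip_of_ne hmk, flip_of_ne hmk, eq_comm] at hm'
  · have hAj := hA k' h.hj
    rw [flip_self, flip_of_ne hjk] at hBj
    rw [flip_self, flip_of_ne hjk, h'.r_k] at hAj
    have h1 := h.num_j
    have h2 := h'.num_k
    have h3 : num W (fun v => SamePair c (v i) l ∧ SamePair c (v k') (q' k')) ≤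
        num W (fun v => SamePair c (v i) l ∧ ¬ SamePair c (v k') (p k')) := by
      refine num_mono fun v _ hv => ⟨hv.1, fun hv' => ?_⟩
      rw [hAj, samePair_compl] at hv
      exact h.not_samePair_j (samePair_trans (samePair_symm hv.2) hv')
    have hpp : SamePair c (p' k') (p k') := samePair_symm (Or.inr hBj.symm)
    have h5 : 0 < num W (fun v => SamePair c (v i) l ∧ SamePair c (v k') (p k')) :=
      num_pos h'.p_mem.1 ⟨Or.inl h'.p_mem.2, hpp⟩
    have h6 : num W (fun v => ¬ SamePair c (v i) l ∧ v k' = r k' ∧ v j' = p j') ≤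
        num W (fun v => ¬ SamePair c (v i) l ∧ ¬ SamePair c (v k') (p k')) :=
      num_mono fun v _ hv => ⟨hv.1, by rw [hv.2.1]; exact h.not_samePair_j⟩
    have h7 : num V (fun v => ¬ SamePair c (v i) l ∧ v j' = r' j' ∧ v k' = p' k') ≤
        num V (fun v => ¬ SamePair c (v i) l ∧ SamePair c (v k') (p k')) :=
      num_mono fun v _ hv => ⟨hv.1, by rw [hv.2.2]; exact hpp⟩
    have h8 := h.four_le_num
    have h9 := h'.four_le_num
    have hj := Finset.mem_erase.1 h.hj
    have h10 := num_cells V (fun v => SamePair c (v i) l) (fun v => SamePair c (v k') (p k'))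
    have h11 := num_cells W (fun v => SamePair c (v i) l) (fun v => SamePair c (v k') (p k'))
    have h12 := (h.crit.toSys.even_num hj.2 (p k')).two_dvd
    have h13 := h.crit.four_le_num_samePair hj.2 (Or.inl h.p_mem.1) (samePair_self _)
    have h14 := h'.crit.four_le_num_samePair hj.2 (Or.inr h.p_mem.1) (samePair_self _)
    have h15 := h.crit.card_le
    have h16 := h.crit.toSys.card_eq
    omega
  · exact h'.j_ne_k rfl

end Balanced

section Unbalanced

variable {ι : Type} {c : S → S}

theorem Rel.of_countP {K : Finset ι} {M N M' N' : Multiset (ι → S)} (h : Rel c K M N)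
    (h' : ∀ x, M'.countP (MemOn K x) + N.countP (MemOn K x) =
      M.countP (MemOn K x) + N'.countP (MemOn K x)) : Rel c K M' N' := fun x hx => by
  have h1 := h x hx
  have h2 := h' x
  omega

theorem AgreeOn.countP_eq {K : Finset ι} {s t : ι → S} (h : AgreeOn K s t) (x : ι → Set S) :
    ({s} : Multiset (ι → S)).countP (MemOn K x) =
      ({t} : Multiset (ι → S)).countP (MemOn K x) := by
  rw [countP_single, countP_single]
  exact if_congr ⟨h.mem, h.symm.mem⟩ rfl rfl

variable [Complementation c]

omit [Complementation c] in
theorem filter_mem_eq_add {V : Finset (ι → S)} {m : ι} {t e : S} {E : Set S}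
    (hE : E ∈ ESet c) (ht : t ∈ E) (he : e ∈ E) (hte : t ≠ e)
    (hV : ∀ v ∈ V, SamePair c (v m) t ∨ SamePair c (v m) e) :
    V.val.filter (fun v => v m ∈ E) = (sl V m t).val + (sl V m e).val := by
  rw [sl_val, sl_val, Multiset.filter_add_filter]
  have h1 : V.val.filter (fun v => v m = t ∧ v m = e) = 0 :=
    Multiset.filter_eq_nil.2 fun v _ h => hte (h.1.symm.trans h.2)
  rw [h1, add_zero]
  refine Multiset.filter_congr fun v hv => ⟨fun h => ?_, ?_⟩
  · rcases hV v hv with (h' | h') | (h' | h')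
    · exact Or.inl h'
    · exact absurd ht ((compl_mem_iff hE t).1 (h' ▸ h))
    · exact Or.inr h'
    · exact absurd he ((compl_mem_iff hE e).1 (h' ▸ h))
  · rintro (h | h)
    · exact h ▸ ht
    · exact h ▸ he

theorem eq_or_eq_of_card_add {C D : Finset (ι → S)} (h : C.card + D.card = 1) :
    ∃ s, C.val + D.val = {s} ∧ (C.val = {s} ∨ D.val = {s}) := by
  obtain h' | h' : C.card = 1 ∧ D.card = 0 ∨ C.card = 0 ∧ D.card = 1 := by omega
  · obtain ⟨s, hs⟩ := Finset.card_eq_one.1 h'.1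
    rw [Finset.card_eq_zero] at h'
    exact ⟨s, by simp [hs, h'.2], Or.inl (by simp [hs])⟩
  · obtain ⟨s, hs⟩ := Finset.card_eq_one.1 h'.2
    rw [Finset.card_eq_zero] at h'
    exact ⟨s, by simp [hs, h'.1], Or.inr (by simp [hs])⟩

theorem Rel.agreeOn_of_singleton {K : Finset ι} {A B s : ι → S} (h : Rel c K {B} {s}) {j k : ι}
    (hj : j ∈ K) (hk : k ∈ K) (hjk : j ≠ k) (hABj : A j ≠ B j) (hABk : A k ≠ B k) :
    AgreeOn K s B := by
  have h' : Rel c K ({s} + {A}) ({A} + {B}) := fun x hx => by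
    have := h x hx
    simp only [Multiset.countP_add] at this ⊢
    omega
  exact h'.agreeOn_of_pair hj hk hjk hABj.symm hABk.symm

theorem TwinFree.false_of_rel {K : Finset ι} {Q : Finset (ι → S)} {m j k : ι}
    (hQ : TwinFree c K Q) (hm : m ∈ K) (hj : j ∈ K.erase m) (hk : k ∈ K.erase m) (hjk : j ≠ k)
    {A B : ι → S} (hABj : A j ≠ B j) (hABk : A k ≠ B k) {M : Multiset (ι → S)} {e : S}
    (h1 : Rel c (K.erase m) (M + {B}) (Polybox.sl Q m e).val)
    (h2 : Rel c (K.erase m) {B} (Polybox.sl Q m (c e)).val)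
    (hle : (Polybox.sl Q m e).card ≤ 4) : False := by
  obtain ⟨s, hs⟩ := Finset.card_eq_one.1 (h2.card_eq.symm : (Polybox.sl Q m (c e)).card = 1)
  rw [hs, Finset.singleton_val] at h2
  have hsB := h2.agreeOn_of_singleton hj hk hjk hABj hABk
  have := five_le_card (hQ.sl m e) (w := B) (fun x hx hxB => ?_) (fun d hd hdB => ?_)
  · omega
  · rw [cov_iff_countP, ← h1 x hx, Multiset.countP_add, countP_single, if_pos hxB]
    omega
  · exact hQ.sl_not_agreeOn hm e d hd s (by simp [hs]) fun n hn =>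
      (hdB n hn).trans (hsB n hn).symm

/-- Two twin-free families whose coverings differ by two words cannot be small. -/
theorem false_of_rel_of_card {K : Finset ι} {T Q : Finset (ι → S)} {m j k : ι} {A B : ι → S}
    (hT : TwinFree c K T) (hQ : TwinFree c K Q) (hTQ : ∀ a ∈ T, ∀ b ∈ Q, ¬ AgreeOn K a b)
    (hm : m ∈ K) (hj : j ∈ K.erase m) (hk : k ∈ K.erase m) (hjk : j ≠ k)
    (hABj : A j ≠ B j) (hABk : A k ≠ B k) (h : Rel c K (T.val + {B}) (Q.val + {A}))
    {t e : S} (hA : A m = t) (hB : B m = t) (hte : ¬ SamePair c t e)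
    (hTm : ∀ v ∈ T, SamePair c (v m) t ∨ SamePair c (v m) e)
    (hQm : ∀ v ∈ Q, SamePair c (v m) t ∨ SamePair c (v m) e)
    (h2 : (sl T m t).card + (sl T m (c t)).card + ((sl Q m t).card + (sl Q m (c t)).card) = 2)
    (h4 : (sl T m e).card + (sl T m (c e)).card + ((sl Q m e).card + (sl Q m (c e)).card) = 4)
    (ih : ∀ C D, TwinFree c (K.erase m) C → TwinFree c (K.erase m) D →
      (∀ v ∈ C, ∀ w ∈ D, ¬ AgreeOn (K.erase m) v w) → C.Nonempty → C.card ≤ 11 →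
      ¬ Rel c (K.erase m) C.val D.val) : False := by
  have hne := Complementation.ne (c := c)
  have hinv := Complementation.invol (c := c)
  have hlet := h.letter hm t
  simp only [Multiset.filter_add, ← sl_val, Multiset.filter_singleton, hA, hB, if_true,
    if_neg (hne t).symm, Multiset.empty_eq_zero, add_zero] at hlet
  have hcard := hlet.card_eq
  simp only [Multiset.card_add, Multiset.card_singleton, Finset.card_val] at hcard
  obtain ⟨s, hs, hs'⟩ := eq_or_eq_of_card_add
    (by omega : (sl T m t).card + (sl Q m (c t)).card = 1)
  obtain ⟨s2, hs2, hs2'⟩ := eq_or_eq_of_card_add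
    (by omega : (sl Q m t).card + (sl T m (c t)).card = 1)
  have hpair : Rel c (K.erase m) ({s} + {B}) ({s2} + {A}) := by
    rw [← hs, ← hs2]
    convert hlet using 1 <;> abel
  have hsA := hpair.agreeOn_of_pair hj hk hjk hABj hABk
  have hs2B := hpair.symm.agreeOn_of_pair hj hk hjk hABj.symm hABk.symm
  have hslice : ∀ e', e' = e ∨ e' = c e → Rel c (K.erase m)
      ((sl T m t).val + (sl T m e').val + {B}) ((sl Q m t).val + (sl Q m e').val + {A}) := by
    intro e' he'
    have hsame : ∀ a, SamePair c a e ↔ SamePair c a e' := fun a => by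
      rcases he' with rfl | rfl
      · rfl
      · exact samePair_compl.symm
    obtain ⟨E, hE, htE, heE⟩ := exists_eSet_pair (c := c) (s := t) (t := e') (by
      rintro rfl
      exact hte ((hsame t).2 (samePair_symm (Or.inr rfl))))
    have hte' : t ≠ e' := fun h' => hte ((hsame t).2 (Or.inl h'))
    have h' := h.slice hm hE
    rw [Multiset.filter_add, Multiset.filter_add, Multiset.filter_singleton,
      Multiset.filter_singleton, hA, hB, if_pos htE, if_pos htE,
      filter_mem_eq_add hE htE heE hte' (fun v hv => (hTm v hv).imp_right (hsame _).1),
      filter_mem_eq_add hE htE heE hte' (fun v hv => (hQm v hv).imp_right (hsame _).1)] at h'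
    exact h'
  have hABne : ∀ {M N : Multiset (ι → S)}, M.card = 0 → N.card = 0 →
      ¬ Rel c (K.erase m) (M + {B}) (N + {A}) := fun hM hN hr => by
    rw [Multiset.card_eq_zero.1 hM, Multiset.card_eq_zero.1 hN, zero_add, zero_add] at hr
    exact hABj (hr.agreeOn_of_singleton hj hk hjk hABj hABk j hj)
  have hAx := fun x => hsA.countP_eq x
  have hBx := fun x => hs2B.countP_eq x
  have hsc := congrArg Multiset.card hs
  have hs2c := congrArg Multiset.card hs2
  simp only [Multiset.card_add, Multiset.card_singleton, Finset.card_val] at hsc hs2c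
  rcases hs' with h5 | h5 <;> rcases hs2' with h6 | h6
  · have key : ∀ e', e' = e ∨ e' = c e → Rel c (K.erase m) (sl T m e').val (sl Q m e').val :=
      fun e' he' => (hslice e' he').of_countP fun x => by
        simp only [Multiset.countP_add, h5, h6, hAx x, hBx x]
        ring
    have hex : ∀ e', e' = e ∨ e' = c e → (sl T m e').card = 0 := fun e' he' => by
      by_contra h'
      refine ih _ _ (hT.sl m e') (hQ.sl m e') (fun a ha b hb hab => ?_)
        (Finset.card_pos.1 (by omega)) ?_ (key e' he')
      · rw [mem_sl] at ha hb
        refine hTQ a ha.1 b hb.1 fun n hn => ?_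
        by_cases hnm : n = m
        · rw [hnm, ha.2, hb.2]
        · exact hab n (Finset.mem_erase.2 ⟨hnm, hn⟩)
      · rcases he' with rfl | rfl <;> omega
    have h7 := (key e (Or.inl rfl)).card_eq
    have h8 := (key _ (Or.inr rfl)).card_eq
    have h9 := hex e (Or.inl rfl)
    have h10 := hex _ (Or.inr rfl)
    simp only [Finset.card_val] at h7 h8
    omega
  · have h7 : (sl Q m t).val = 0 := by
      rw [h6] at hs2
      simpa using hs2
    have key : ∀ e', e' = e ∨ e' = c e →
        Rel c (K.erase m) ((sl T m e').val + {B}) (sl Q m e').val :=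
      fun e' he' => (hslice e' he').of_countP fun x => by
        simp only [Multiset.countP_add, h5, h7, hAx x, Multiset.countP_zero]
        ring
    have k1 := key e (Or.inl rfl)
    have k2 := key _ (Or.inr rfl)
    have h8 := k1.card_eq
    have h9 := k2.card_eq
    simp only [Multiset.card_add, Multiset.card_singleton, Finset.card_val] at h8 h9
    obtain h10 | h10 : (sl T m e).card = 0 ∨ (sl T m (c e)).card = 0 := by omega
    · rw [Finset.card_eq_zero] at h10
      refine hQ.false_of_rel hm hj hk hjk hABj hABk k2 ?_ (by omega)
      simpa only [hinv, h10, Finset.empty_val, zero_add] using k1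
    · rw [Finset.card_eq_zero] at h10
      refine hQ.false_of_rel hm hj hk hjk hABj hABk k1 ?_ (by omega)
      simpa only [h10, Finset.empty_val, zero_add] using k2
  · have h7 : (sl T m t).val = 0 := by
      rw [h5] at hs
      simpa using hs
    have key : ∀ e', e' = e ∨ e' = c e →
        Rel c (K.erase m) ((sl Q m e').val + {A}) (sl T m e').val :=
      fun e' he' => (hslice e' he').symm.of_countP fun x => by
        simp only [Multiset.countP_add, h6, h7, hBx x, Multiset.countP_zero]
        ring
    have k1 := key e (Or.inl rfl)
    have k2 := key _ (Or.inr rfl)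
    have h8 := k1.card_eq
    have h9 := k2.card_eq
    simp only [Multiset.card_add, Multiset.card_singleton, Finset.card_val] at h8 h9
    obtain h10 | h10 : (sl Q m e).card = 0 ∨ (sl Q m (c e)).card = 0 := by omega
    · rw [Finset.card_eq_zero] at h10
      refine hT.false_of_rel hm hj hk hjk hABj.symm hABk.symm k2 ?_ (by omega)
      simpa only [hinv, h10, Finset.empty_val, zero_add] using k1
    · rw [Finset.card_eq_zero] at h10
      refine hT.false_of_rel hm hj hk hjk hABj.symm hABk.symm k1 ?_ (by omega)
      simpa only [h10, Finset.empty_val, zero_add] using k2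
  · have h7 : (sl T m t).val = 0 := by
      rw [h5] at hs
      simpa using hs
    have h8 : (sl Q m t).val = 0 := by
      rw [h6] at hs2
      simpa using hs2
    have key : ∀ e', e' = e ∨ e' = c e →
        Rel c (K.erase m) ((sl T m e').val + {B}) ((sl Q m e').val + {A}) := fun e' he' => by
      simpa only [h7, h8, zero_add] using hslice e' he'
    have hpos : ∀ e', e' = e ∨ e' = c e → 0 < (sl T m e').card ∧
        (sl T m e').card = (sl Q m e').card := fun e' he' => by
      have h9 := (key e' he').card_eq
      simp only [Multiset.card_add, Multiset.card_singleton, Finset.card_val] at h9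
      refine ⟨Nat.pos_of_ne_zero fun h10 => ?_, by omega⟩
      exact hABne (by simpa using h10) (by simp only [Finset.card_val]; omega) (key e' he')
    have p1 := hpos e (Or.inl rfl)
    have p2 := hpos _ (Or.inr rfl)
    have hex : ∀ e', e' = e ∨ e' = c e → ∃ u ∈ sl T m e', AgreeOn (K.erase m) u A := by
      intro e' he'
      have h9 : (sl T m e').card = 1 ∧ (sl Q m e').card = 1 := by
        rcases he' with rfl | rfl <;> omega
      obtain ⟨u, hu⟩ := Finset.card_eq_one.1 h9.1
      obtain ⟨v, hv⟩ := Finset.card_eq_one.1 h9.2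
      have h10 := key e' he'
      rw [hu, hv, Finset.singleton_val, Finset.singleton_val] at h10
      exact ⟨u, by simp [hu], h10.agreeOn_of_pair hj hk hjk hABj hABk⟩
    obtain ⟨u, hu, huA⟩ := hex e (Or.inl rfl)
    obtain ⟨v, hv, hvA⟩ := hex _ (Or.inr rfl)
    exact hT.sl_not_agreeOn hm e u hu v hv fun n hn => (huA n hn).trans (hvA n hn).symm

variable {J : Finset ι} {V W : Finset (ι → S)} {i j k : ι} {l : S} {p q r s : ι → S}

theorem Quad.exists_position (h : Quad c J V W i j k l p q r s)
    (h4 : num V (fun v => SamePair c (v i) l) = 4) (h6 : num W (fun v => SamePair c (v i) l) = 6)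
    (h11 : V.card = 11) : ∃ m ∈ J.erase i, m ≠ j ∧ m ≠ k ∧ ∃ e, ¬ SamePair c (q m) e ∧
      (∀ w ∈ W, SamePair c (w m) (q m) ∨ SamePair c (w m) e) ∧
      num W (fun v => SamePair c (v i) l ∧ SamePair c (v m) (q m)) = 2 ∧
      num W (fun v => SamePair c (v i) l ∧ SamePair c (v m) e) = 4 := by
  obtain ⟨b₀, hb₀, -, hiff⟩ := h.crit.exists_other h.hi (Or.inl h.p_mem.1) (Or.inl h.p_mem.2)
  have e1 : num W (fun v => SamePair c (v i) (b₀ i)) = num W (fun v => ¬ SamePair c (v i) l) :=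
    num_congr fun v hv => hiff v (Or.inr hv)
  have e2 := num_compl W (fun v => SamePair c (v i) l)
  have e3 := h.crit.toSys.card_eq
  obtain ⟨m, hm, b, hb, g1, g2, g3, g4, g5⟩ :=
    h.crit.symm.exists_cells h.hi (Or.inr hb₀) (samePair_self _) (by omega)
  have hm' := Finset.mem_erase.1 hm
  have t1 : num W (fun v => ¬ SamePair c (v i) (b₀ i) ∧ SamePair c (v m) (b m)) =
      num W (fun v => SamePair c (v i) l ∧ SamePair c (v m) (b m)) :=
    num_congr fun v hv => by rw [hiff v (Or.inr hv), not_not]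
  have t2 : num V (fun v => ¬ SamePair c (v i) (b₀ i) ∧ ¬ SamePair c (v m) (b m)) =
      num V (fun v => SamePair c (v i) l ∧ ¬ SamePair c (v m) (b m)) :=
    num_congr fun v hv => by rw [hiff v (Or.inl hv), not_not]
  have t3 : num W (fun v => SamePair c (v i) (b₀ i) ∧ SamePair c (v m) (b m)) =
      num W (fun v => ¬ SamePair c (v i) l ∧ SamePair c (v m) (b m)) :=
    num_congr fun v hv => by rw [hiff v (Or.inr hv)]
  have a1 := num_cells V (fun v => SamePair c (v i) l) (fun v => SamePair c (v m) (b m))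
  have a2 := num_cells W (fun v => SamePair c (v i) l) (fun v => SamePair c (v m) (b m))
  have a3 := (h.crit.toSys.even_num_and h.hi hm'.2 hm'.1 l (b m)).two_dvd
  have a4 := (h.crit.symm.four_le_num_samePair hm'.2 (Or.inl hb) (samePair_self _)).2
  have hz : ∀ v ∈ V, SamePair c (v i) l → ¬ SamePair c (v m) (b m) := fun v hv hvl hvm => by
    have := num_pos (p := fun v => SamePair c (v i) l ∧ SamePair c (v m) (b m)) hv ⟨hvl, hvm⟩
    omega
  have hor : ∀ a ∈ V, SamePair c (a i) l → ∀ n, n ∈ J → n = m → ∀ u ∈ V, SamePair c (u i) l →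
      SamePair c (u n) (a n) := by
    rintro a ha hal n hn rfl u hu hul
    by_contra hno
    rcases h.crit.samePair_or hn (Or.inl ha) (Or.inl hu) (Or.inr hb) hno with h' | h'
    · exact hz a ha hal (samePair_symm h')
    · exact hz u hu hul (samePair_symm h')
  have hql := hz q h.q_mem.1 (Or.inl h.q_mem.2)
  have hW : ∀ w ∈ W, SamePair c (w m) (q m) ↔ ¬ SamePair c (w m) (b m) := fun w hw => by
    refine ⟨fun h1 h2 => hql (samePair_trans (samePair_symm h1) h2), fun h1 => ?_⟩
    exact (h.crit.samePair_or hm'.2 (Or.inl h.q_mem.1) (Or.inr hb) (Or.inr hw)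
      (fun h' => hql (samePair_symm h'))).resolve_right h1
  have t4 : num W (fun v => SamePair c (v i) l ∧ SamePair c (v m) (q m)) =
      num W (fun v => SamePair c (v i) l ∧ ¬ SamePair c (v m) (b m)) :=
    num_congr fun v hv => by rw [hW v hv]
  refine ⟨m, hm, ?_, ?_, b m, hql, fun w hw => ?_, by omega, by omega⟩
  · rintro rfl
    exact h.not_samePair_j (hor p h.p_mem.1 (Or.inl h.p_mem.2) m hm'.2 rfl r h.r_mem.1
      (Or.inr h.r_mem.2))
  · rintro rfl
    exact h.not_samePair_k (hor q h.q_mem.1 (Or.inl h.q_mem.2) m hm'.2 rfl p h.p_mem.1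
      (Or.inl h.p_mem.2))
  · rw [hW w hw]
    exact (em _).symm

/-- A letter pair occurring four times in one code cannot occur six times in the other. -/
theorem Quad.false_of_six (h : Quad c J V W i j k l p q r s)
    (h4 : num V (fun v => SamePair c (v i) l) = 4) (h6 : num W (fun v => SamePair c (v i) l) = 6)
    (h11 : V.card = 11) : False := by
  obtain ⟨m, hm, hmj, hmk, e, hqe, hW, h2, h4'⟩ := h.exists_position h4 h6 h11
  rw [num_samePair_and] at h2 h4'
  obtain ⟨hA, hB⟩ := h.flip_agreeOn hm hmj hmk
  refine false_of_rel_of_card (h.crit.right.sl i l) (h.crit.right.sl i (c l))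
    (h.crit.right.sl_not_agreeOn h.hi l) hm (Finset.mem_erase.2 ⟨hmj.symm, h.hj⟩)
    (Finset.mem_erase.2 ⟨hmk.symm, h.k_mem⟩) h.j_ne_k h.flip_ne_j h.flip_ne_k h.rel_right hA hB hqe
    (fun v hv => hW v (mem_sl.1 hv).1) (fun v hv => hW v (mem_sl.1 hv).1) h2 h4' ?_
  intro C D hC hD hCD hne hle
  exact h.crit.not_rel ((Finset.erase_subset _ _).trans_ssubset (Finset.erase_ssubset h.hi))
    hC hD hCD hne hle

end Unbalanced

section Main

variable {ι : Type} {c : S → S} [Complementation c] {J : Finset ι} {V W : Finset (ι → S)}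

theorem Crit.num_ne_four (h : Crit c J V W) {i : ι} {l : S} (hi : i ∈ J) {a : ι → S}
    (ha : a ∈ V ∨ a ∈ W) (hal : SamePair c (a i) l) :
    num V (fun v => SamePair c (v i) l) ≠ 4 := fun h4 => by
  obtain ⟨j, k, p, q, r, s, hq⟩ := h.exists_quad hi ha hal h4
  rcases h.exists_cells_of_eq_four hi ha hal h4 with h' | h'
  · obtain ⟨j', k', p', q', r', s', hq'⟩ := h.symm.exists_quad hi ha.symm hal h'.1
    exact hq.false_of_quad hq' h4 h'.1
  · exact hq.false_of_six h4 h'.1 h'.2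

theorem Crit.elim (h : Crit c J V W) : False := by
  obtain ⟨i, hi, a, ha, h4 | h4⟩ := h.exists_eq_four
  · exact h.num_ne_four hi ha (samePair_self _) h4
  · exact h.symm.num_ne_four hi ha.symm (samePair_self _) h4

theorem Sys.twelve_le_card (h : Sys c J V W) (hV : V.Nonempty) : 12 ≤ V.card := by
  induction J using Finset.strongInduction generalizing V W with
  | H J ih =>
    by_contra hlt
    exact Crit.elim ⟨h, hV, by omega, fun J' hJ V' W' h' hV' => ih J' hJ h' hV'⟩

end Main

section Realization

variable {d : ℕ} {c : S → S}

theorem mem_realizeSet {V : Set (Fin d → S)} (x : Fin d → Set S) :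
    x ∈ RealizeSet c V ↔ ∃ v ∈ V, Transversal c x ∧ MemOn Finset.univ x v := by
  simp only [RealizeSet, Realize, ELetter, Set.mem_iUnion, Set.mem_ofPred_eq, exists_prop,
    Transversal, MemOn, forall_and, Finset.mem_univ, true_implies]

theorem twinFree_of_polyboxCode {V : Set (Fin d → S)} (hV : PolyboxCode c V)
    (hVt : NoTwinPair c V) {D : Finset (Fin d → S)} (hD : ∀ v, v ∈ D ↔ v ∈ V) :
    TwinFree c Finset.univ D := by
  refine ⟨fun u hu v hv huv => ?_, fun u hu v hv => ?_⟩
  · obtain ⟨j, hj⟩ := hV u ((hD u).1 hu) v ((hD v).1 hv) huv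
    exact ⟨j, Finset.mem_univ j, hj⟩
  · rintro ⟨j, -, hj, h⟩
    exact hVt u ((hD u).1 hu) v ((hD v).1 hv) ⟨j, hj, fun i => h i (Finset.mem_univ i)⟩

end Realization

end Polybox

theorem disjoint_equiv_codes_ge_twelve {d : ℕ} [Fintype S] (c : S → S)
    (hinv : Function.Involutive c) (hfix : ∀ s, c s ≠ s) (hd : 4 ≤ d)
    (V W : Set (Fin d → S))
    (hVne : V.Nonempty) (hWne : W.Nonempty)
    (hV : PolyboxCode c V) (hW : PolyboxCode c W)
    (hdisj : Disjoint V W) (heq : EquivCodes c V W)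
    (hVt : NoTwinPair c V) (hWt : NoTwinPair c W) :
    12 ≤ V.ncard := by
  have : Polybox.Complementation c := ⟨hinv, hfix⟩
  have hVf := V.toFinite
  have hWf := W.toFinite
  rw [Set.ncard_eq_toFinset_card V hVf]
  refine Polybox.Sys.twelve_le_card (c := c) (J := Finset.univ) (W := hWf.toFinset)
    ⟨Polybox.twinFree_of_polyboxCode hV hVt fun v => hVf.mem_toFinset,
      Polybox.twinFree_of_polyboxCode hW hWt fun v => hWf.mem_toFinset,
      fun v hv w hw h => ?_, fun x hx => ?_⟩ (hVf.toFinset_nonempty.2 hVne)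
  · have hvw : v = w := funext fun i => h i (Finset.mem_univ i)
    rw [hVf.mem_toFinset] at hv
    rw [hWf.mem_toFinset, ← hvw] at hw
    exact Set.disjoint_left.1 hdisj hv hw
  · have h1 := Polybox.mem_realizeSet (c := c) (V := V) x
    have h2 := Polybox.mem_realizeSet (c := c) (V := W) x
    rw [heq] at h1
    simp only [hx, true_and] at h1 h2
    simp only [Set.Finite.mem_toFinset]
    exact h1.symm.trans h2
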